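/- For every real w > 1, the family (|L(1/2, χ_{d0})|³ · q^{−w·deg d0}), indexed by the non-constant monic squarefree polynomials d0 ∈ F[x], is summable; that is, the series Σ_{d0 monic squarefree, deg d0 ≥ 1} L(1/2, χ_{d0})³ |d0|^{−w} converges absolutely for w > 1. -/

import Mathlib

open scoped Classical in
/-- The quadratic residue symbol at a monic irreducible `p`: `0` if `p ∣ d`, `1` if `d` is
congruent to a nonzero square modulo `p`, and `−1` otherwise. -/
noncomputable def legSym {F : Type} [Field F] (d p : Polynomial F) : ℤ :=
  if p ∣ d then 0
  else if ∃ a : Polynomial F, ¬ p ∣ a ∧ p ∣ (a ^ 2 - d) then 1 else -1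

/-- The quadratic character `χ_d`, the completely multiplicative extension of `legSym d`
to monic polynomials via the (monic) irreducible factorization. -/
noncomputable def quadChar {F : Type} [Field F] (d m : Polynomial F) : ℤ :=
  haveI := Classical.decEq F
  ((UniqueFactorizationMonoid.normalizedFactors m).map (fun p => legSym d p)).prod

/-- The monic polynomial of degree `n` with lower-order coefficients `a 0, …, a (n−1)`:
`X^n + Σ_{i<n} a_i X^i`.  This parametrizes the monic polynomials of degree `n`. -/
noncomputable def monicOf {F : Type} [Field F] (n : ℕ) (a : Fin n → F) : Polynomial F :=
  Polynomial.X ^ n + ∑ i : Fin n, Polynomial.C (a i) * Polynomial.X ^ (i : ℕ)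

/-- The central value `L(1/2, χ_d) = Σ_{n=0}^{deg d − 1} q^{−n/2} Σ_{m monic, deg m = n} χ_d(m)`. -/
noncomputable def Lhalf (q : ℕ) {F : Type} [Field F] [Fintype F] (d : Polynomial F) : ℝ :=
  ∑ n ∈ Finset.range d.natDegree,
    (q : ℝ) ^ (-(n : ℝ) / 2) * ∑ a : Fin n → F, (quadChar d (monicOf n a) : ℝ)

open scoped Classical in
/-- The cubic moment `a_D = Σ_{d₀ monic squarefree, deg d₀ = D} L(1/2, χ_{d₀})³`. -/
noncomputable def momentSum (q : ℕ) (F : Type) [Field F] [Fintype F] (D : ℕ) : ℝ :=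
  ∑ a : Fin D → F, if Squarefree (monicOf D a) then (Lhalf q (monicOf D a)) ^ 3 else 0

open Polynomial

section DigitPolynomial

variable {K : Type*} [Field K]

/-- The polynomial with coefficient `u (i, j)` at the exponent `i * M + j * N`. -/
noncomputable def gridPoly (M N : ℕ) {a b : ℕ} (u : Fin a × Fin b → K) : K[X] :=
  ∑ ij : Fin a × Fin b, monomial ((ij.1 : ℕ) * M + (ij.2 : ℕ) * N) (u ij)

lemma gridPoly_add (M N : ℕ) {a b : ℕ} (u v : Fin a × Fin b → K) :
    gridPoly M N (u + v) = gridPoly M N u + gridPoly M N v := by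
  simp [gridPoly, Finset.sum_add_distrib]

lemma eval_gridPoly (M N : ℕ) {a b : ℕ} (u : Fin a × Fin b → K) (x : K) :
    (gridPoly M N u).eval x =
      ∑ ij : Fin a × Fin b, u ij * x ^ ((ij.1 : ℕ) * M + (ij.2 : ℕ) * N) := by
  simp [gridPoly, eval_finsetSum, eval_monomial]

lemma exists_natDegree_gridPoly (M N : ℕ) {a b : ℕ} {u : Fin a × Fin b → K}
    (h : gridPoly M N u ≠ 0) :
    ∃ i < a, ∃ j < b, (gridPoly M N u).natDegree = i * M + j * N := by
  have h1 : (gridPoly M N u).coeff (gridPoly M N u).natDegree ≠ 0 := by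
    simpa using h
  rw [gridPoly, finsetSum_coeff] at h1
  obtain ⟨ij, -, hij⟩ := Finset.exists_ne_zero_of_sum_ne_zero h1
  rw [coeff_monomial] at hij
  refine ⟨ij.1, ij.1.2, ij.2, ij.2.2, ?_⟩
  by_contra hne
  exact hij (if_neg fun h => hne h.symm)

lemma natDegree_gridPoly_le (M N : ℕ) {a b : ℕ} (u : Fin a × Fin b → K) :
    (gridPoly M N u).natDegree ≤ (a - 1) * M + (b - 1) * N := by
  rcases eq_or_ne (gridPoly M N u) 0 with h | h
  · simp [h]
  · obtain ⟨i, hi, j, hj, hd⟩ := exists_natDegree_gridPoly M N h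
    rw [hd]
    gcongr <;> omega

lemma eq_zero_of_gridPoly_eq_zero {N a b : ℕ} (hb : b ≤ N) {u : Fin a × Fin b → K}
    (h : gridPoly N 1 u = 0) : u = 0 := by
  funext ij
  have h1 : (gridPoly N 1 u).coeff ((ij.1 : ℕ) * N + (ij.2 : ℕ) * 1) = u ij := by
    rw [gridPoly, finsetSum_coeff, Finset.sum_eq_single ij]
    · simp
    · intro kl _ hne
      rw [coeff_monomial, if_neg]
      intro heq
      apply hne
      have hN : 0 < N := lt_of_lt_of_le (lt_of_le_of_lt (Nat.zero_le _) ij.2.2) hb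
      have hk := kl.2.2.trans_le hb
      have hj := ij.2.2.trans_le hb
      have e1 : (kl.1 : ℕ) = ij.1 := by
        have := congrArg (· / N) heq
        simpa [Nat.add_div_of_dvd_right, Nat.div_eq_of_lt hk, Nat.div_eq_of_lt hj, hN] using this
      have e2 : (kl.2 : ℕ) = ij.2 := by rw [e1] at heq; omega
      exact Prod.ext (Fin.ext e1) (Fin.ext e2)
    · simp
  rw [← h1, h]; simp

end DigitPolynomial

section Bombieri

variable {K : Type*} [Field K]

lemma gridPoly_add_pow_mul_gridPoly_ne_zero {f : K[X]} {g h : ℕ} (hf : f.natDegree = 2 * g + 1)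
    {a b : ℕ} {u : Fin a × Fin (h + 1) → K} {v : Fin b × Fin (h - g) → K}
    (huv : ¬ (u = 0 ∧ v = 0)) :
    gridPoly (2 * h + 1) 1 u + f ^ (h + 1) * gridPoly (2 * h + 1) 1 v ≠ 0 := by
  intro h0
  rcases eq_or_ne (gridPoly (2 * h + 1) 1 v) 0 with hv | hv
  · rw [hv, mul_zero, add_zero] at h0
    exact huv ⟨eq_zero_of_gridPoly_eq_zero (by omega) h0,
      eq_zero_of_gridPoly_eq_zero (by omega) hv⟩
  · have hf0 : f ≠ 0 := by rintro rfl; simp at hf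
    have hu : gridPoly (2 * h + 1) 1 u = - (f ^ (h + 1) * gridPoly (2 * h + 1) 1 v) :=
      eq_neg_of_add_eq_zero_left h0
    have hu0 : gridPoly (2 * h + 1) 1 u ≠ 0 := by
      rw [hu, neg_ne_zero]; exact mul_ne_zero (pow_ne_zero _ hf0) hv
    obtain ⟨i, hi, j, hj, hij⟩ := exists_natDegree_gridPoly _ _ hu0
    obtain ⟨k, hk, l, hl, hkl⟩ := exists_natDegree_gridPoly _ _ hv
    have hd := congrArg natDegree hu
    rw [natDegree_neg, natDegree_mul (pow_ne_zero _ hf0) hv, natDegree_pow, hf, hij, hkl] at hd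
    have e : (h + 1) * (2 * g + 1) + (k * (2 * h + 1) + l * 1)
        = (g + h + 1 + l) + (2 * h + 1) * (g + k) := by ring
    have e' : i * (2 * h + 1) + j * 1 = j + (2 * h + 1) * i := by ring
    rw [e, e'] at hd
    have := congrArg (· % (2 * h + 1)) hd
    simp only [Nat.add_mul_mod_self_left] at this
    rw [Nat.mod_eq_of_lt (by omega), Nat.mod_eq_of_lt (by omega)] at this
    omega

variable [Fintype K]

/-- Bombieri's form of Stepanov's method for the curve `y² = f(x)` with `f` of odd degree. -/
theorem card_isSquare_eval_lt (p : ℕ) [Fact p.Prime] [CharP K p] {s g h : ℕ}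
    (hQ : p ^ s = 2 * h + 1) (hK : Fintype.card K = (2 * h + 1) ^ 2) {f : K[X]}
    (hf : f.natDegree = 2 * g + 1) (hgh : g < h) [DecidablePred fun x : K => IsSquare (f.eval x)] :
    (Finset.univ.filter fun x : K => IsSquare (f.eval x)).card < (h + 1 + g) * (2 * h + 1) := by
  set Q := 2 * h + 1 with hQdef
  have hf0 : f ≠ 0 := by rintro rfl; simp at hf
  have frob_add : ∀ x y : K, (x + y) ^ Q = x ^ Q + y ^ Q := fun x y => by
    rw [← hQ]; exact add_pow_char_pow x y p s
  have frob_sum : ∀ {ι : Type} (t : Finset ι) (F : ι → K), (∑ i ∈ t, F i) ^ Q = ∑ i ∈ t, F i ^ Q :=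
    fun t F => by rw [← hQ]; exact sum_pow_char_pow p _ t F
  have hcard : ∀ x : K, x ^ (Q * Q) = x := fun x => by
    rw [← pow_two, ← hK]; exact FiniteField.pow_card x
  -- the auxiliary semilinear map
  let E := (Fin (h + 1 + g) × Fin (h + 1) → K) × (Fin (h + 1) × Fin (h - g) → K)
  have hdeg : ∀ w : E, gridPoly 1 Q (fun ij => w.1 ij ^ Q) +
      f ^ (h + 1) * gridPoly 1 Q (fun ij => w.2 ij ^ Q) ∈ degreeLT K (h + 1 + g + h * Q) := by
    intro w
    rw [mem_degreeLT]
    have h1 := natDegree_gridPoly_le 1 Q (fun ij => w.1 ij ^ Q)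
    have h2 := natDegree_gridPoly_le 1 Q (fun ij => w.2 ij ^ Q)
    have h3 : (f ^ (h + 1) * gridPoly 1 Q (fun ij => w.2 ij ^ Q)).natDegree ≤
        (h + 1) * (2 * g + 1) + (gridPoly 1 Q (fun ij => w.2 ij ^ Q)).natDegree := by
      refine natDegree_mul_le.trans ?_
      rw [natDegree_pow, hf]
    refine lt_of_le_of_lt (degree_add_le _ _) (max_lt ?_ ?_)
    · refine lt_of_le_of_lt degree_le_natDegree ?_
      norm_cast
      refine lt_of_le_of_lt h1 ?_
      simp only [Nat.add_sub_cancel]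
      omega
    · refine lt_of_le_of_lt degree_le_natDegree ?_
      norm_cast
      refine lt_of_le_of_lt (h3.trans (Nat.add_le_add_left h2 _)) ?_
      obtain ⟨e, rfl⟩ : ∃ e, h = g + 1 + e := ⟨h - g - 1, by omega⟩
      have : g + 1 + e - g - 1 = e := by omega
      rw [this, hQdef]
      simp only [Nat.add_sub_cancel]
      nlinarith
  let δ : E → degreeLT K (h + 1 + g + h * Q) := fun w => ⟨_, hdeg w⟩
  have hlt : Nat.card (degreeLT K (h + 1 + g + h * Q)) < Nat.card E := by
    have e1 : Nat.card (degreeLT K (h + 1 + g + h * Q)) =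
        Fintype.card K ^ (h + 1 + g + h * Q) := by
      rw [Nat.card_congr (degreeLTEquiv K _).toEquiv]
      simp
    have e2 : Nat.card E = Fintype.card K ^ ((h + 1 + g) * (h + 1) + (h + 1) * (h - g)) := by
      simp only [E]
      rw [Nat.card_prod]
      simp [pow_add]
    rw [e1, e2]
    refine Nat.pow_lt_pow_right Fintype.one_lt_card ?_
    obtain ⟨e, rfl⟩ : ∃ e, h = g + 1 + e := ⟨h - g - 1, by omega⟩
    have : g + 1 + e - g = 1 + e := by omega
    rw [this, hQdef]
    nlinarith
  have hninj : ¬ Function.Injective δ := fun hinj => by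
    have : Finite (degreeLT K (h + 1 + g + h * Q)) :=
      Finite.of_equiv _ (degreeLTEquiv K _).symm.toEquiv
    exact absurd (Nat.card_le_card_of_injective δ hinj) (not_le.mpr hlt)
  obtain ⟨w₁, w₂, hw, hne⟩ : ∃ w₁ w₂, δ w₁ = δ w₂ ∧ w₁ ≠ w₂ := by
    simpa [Function.Injective] using hninj
  set w := w₁ - w₂ with hwdef
  have hw0 : gridPoly 1 Q (fun ij => w.1 ij ^ Q) +
      f ^ (h + 1) * gridPoly 1 Q (fun ij => w.2 ij ^ Q) = 0 := by
    have hsub : w₁ = w + w₂ := by simp [hwdef]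
    have := congrArg Subtype.val hw
    simp only [δ, hsub] at this
    have k1 : (fun ij => (w + w₂).1 ij ^ Q) = (fun ij => w.1 ij ^ Q) + fun ij => w₂.1 ij ^ Q := by
      funext ij; exact frob_add _ _
    have k2 : (fun ij => (w + w₂).2 ij ^ Q) = (fun ij => w.2 ij ^ Q) + fun ij => w₂.2 ij ^ Q := by
      funext ij; exact frob_add _ _
    rw [k1, k2, gridPoly_add, gridPoly_add] at this
    linear_combination this
  have hwne : ¬ (w.1 = 0 ∧ w.2 = 0) := fun hh => hne (by
    rw [← sub_eq_zero]; exact Prod.ext hh.1 hh.2)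
  set G := gridPoly Q 1 w.1 + f ^ (h + 1) * gridPoly Q 1 w.2 with hG
  have hG0 : G ≠ 0 := gridPoly_add_pow_mul_gridPoly_ne_zero hf hwne
  have hroot : ∀ x : K, IsSquare (f.eval x) → G.IsRoot x := by
    rintro x ⟨y, hy⟩
    have hfx : (f.eval x ^ (h + 1)) ^ Q = f.eval x ^ (h + 1) := by
      have e : 2 * ((h + 1) * Q) = Q * Q + Q := by rw [hQdef]; ring
      have e' : 2 * (h + 1) = Q + 1 := by rw [hQdef]; ring
      rw [hy, ← pow_two, ← pow_mul, ← pow_mul, ← pow_mul, e, pow_add y (Q * Q), hcard, e',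
        pow_succ' y Q]
    have key : ∀ {a b : ℕ} (u : Fin a × Fin b → K), ((gridPoly Q 1 u).eval x) ^ Q =
        (gridPoly 1 Q (fun ij => u ij ^ Q)).eval x := by
      intro a b u
      rw [eval_gridPoly, eval_gridPoly, frob_sum]
      refine Finset.sum_congr rfl fun ij _ => ?_
      have e : ((ij.1 : ℕ) * Q + (ij.2 : ℕ) * 1) * Q = Q * Q * ij.1 + ij.2 * Q := by ring
      rw [mul_pow, ← pow_mul, e, pow_add x, pow_mul x (Q * Q), hcard, pow_add x, mul_one]
    have : (G.eval x) ^ Q = 0 := by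
      rw [hG, eval_add, eval_mul, eval_pow, frob_add, mul_pow, hfx, key, key, ← eval_pow,
        ← eval_mul, ← eval_add, hw0, eval_zero]
    exact pow_eq_zero_iff (by omega) |>.mp this
  have hGdeg : G.natDegree < (h + 1 + g) * Q := by
    have h1 := natDegree_gridPoly_le Q 1 w.1
    have h2 := natDegree_gridPoly_le Q 1 w.2
    have h3 : (f ^ (h + 1) * gridPoly Q 1 w.2).natDegree ≤
        (h + 1) * (2 * g + 1) + (gridPoly Q 1 w.2).natDegree := by
      refine natDegree_mul_le.trans ?_
      rw [natDegree_pow, hf]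
    refine lt_of_le_of_lt (natDegree_add_le _ _) (max_lt ?_ ?_)
    · refine lt_of_le_of_lt h1 ?_
      have : h + 1 + g - 1 = h + g := by omega
      rw [this, hQdef]
      simp only [Nat.add_sub_cancel]
      nlinarith
    · refine lt_of_le_of_lt (h3.trans (Nat.add_le_add_left h2 _)) ?_
      obtain ⟨e, rfl⟩ : ∃ e, h = g + 1 + e := ⟨h - g - 1, by omega⟩
      have : g + 1 + e - g - 1 = e := by omega
      rw [this, hQdef]
      simp only [Nat.add_sub_cancel]
      nlinarith
  refine lt_of_le_of_lt ?_ hGdeg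
  classical
  refine le_trans (Finset.card_le_card ?_) ((Multiset.toFinset_card_le G.roots).trans
    (card_roots' G))
  intro x hx
  rw [Multiset.mem_toFinset, mem_roots hG0]
  exact hroot x (Finset.mem_filter.mp hx).2


/-- Weil's bound for the quadratic character sum of a polynomial of odd degree, over a field of
square cardinality that is large enough. -/
theorem abs_sum_quadraticChar_eval_le_of_odd [DecidableEq K] (p : ℕ) [Fact p.Prime] [CharP K p]
    {s g h : ℕ} (hQ : p ^ s = 2 * h + 1) (hK : Fintype.card K = (2 * h + 1) ^ 2) {f : K[X]}
    (hf : f.natDegree = 2 * g + 1) (hgh : g < h) :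
    |∑ x : K, quadraticChar K (f.eval x)| ≤ (2 * g + 1) * (2 * h + 1) := by
  have h2 : ringChar K ≠ 2 := by
    intro h2
    have := FiniteField.even_card_of_char_two h2
    rw [hK] at this
    have h3 : ((2 * h + 1) ^ 2) % 2 = 1 := by
      rw [Nat.pow_mod]; simp
    omega
  obtain ⟨ν, hν⟩ := quadraticChar_exists_neg_one h2
  have hν0 : ν ≠ 0 := by rintro rfl; simp at hν
  have hf' : (C ν * f).natDegree = 2 * g + 1 := by rw [natDegree_C_mul hν0, hf]
  have b1 := card_isSquare_eval_lt p hQ hK hf hgh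
  have b2 := card_isSquare_eval_lt p hQ hK hf' hgh
  have key : ∀ e : K[X], 2 * ((Finset.univ.filter fun x : K => IsSquare (e.eval x)).card : ℤ) ≥
      (2 * h + 1) ^ 2 + ∑ x : K, quadraticChar K (e.eval x) := by
    intro e
    have h1 : ((2 * h + 1 : ℕ) : ℤ) ^ 2 = ∑ x : K, 1 := by
      simp [hK]
    push_cast at h1
    rw [Finset.card_filter, h1, ← Finset.sum_add_distrib]
    push_cast
    rw [Finset.mul_sum]
    refine Finset.sum_le_sum fun x _ => ?_
    by_cases hx : IsSquare (e.eval x)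
    · rw [if_pos hx]
      by_cases h0 : e.eval x = 0
      · simp [h0]
      · rw [(quadraticChar_one_iff_isSquare h0).mpr hx]; norm_num
    · rw [if_neg hx, quadraticChar_neg_one_iff_not_isSquare.mpr hx]; norm_num
  have k1 := key f
  have k2 := key (C ν * f)
  have e2 : ∑ x : K, quadraticChar K ((C ν * f).eval x) = -∑ x : K, quadraticChar K (f.eval x) := by
    simp [map_mul, hν]
  rw [e2] at k2
  zify at b1 b2
  rw [abs_le]
  constructor <;> nlinarith

/-- Weil's bound for the quadratic character sum of a polynomial with a simple root. -/
theorem abs_sum_quadraticChar_eval_le [DecidableEq K] (p : ℕ) [Fact p.Prime] [CharP K p]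
    {s h : ℕ} (hQ : p ^ s = 2 * h + 1) (hK : Fintype.card K = (2 * h + 1) ^ 2) {f : K[X]}
    {β : K} (hβ : f.IsRoot β) (hβ' : f.derivative.eval β ≠ 0) (hdeg : f.natDegree ≤ 2 * h) :
    |∑ x : K, quadraticChar K (f.eval x)| ≤ (f.natDegree + 1) * (2 * h + 1) := by
  have hf0 : f ≠ 0 := by rintro rfl; simp at hβ'
  obtain ⟨g, hg⟩ := Nat.even_or_odd' f.natDegree
  rcases hg with hg | hg
  swap
  · refine (abs_sum_quadraticChar_eval_le_of_odd p hQ hK hg (by omega)).trans ?_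
    rw [hg]; push_cast; nlinarith
  set F := f.comp (X + C β) with hF
  have hFdeg : F.natDegree = f.natDegree := by
    rw [hF, natDegree_comp, natDegree_X_add_C, mul_one]
  have hF0 : F.coeff 0 = 0 := by
    rw [coeff_zero_eq_eval_zero, hF]; simpa [eval_comp] using hβ
  have hF1 : F.coeff 1 ≠ 0 := by
    have : F.derivative.coeff 0 ≠ 0 := by
      rw [coeff_zero_eq_eval_zero, hF, derivative_comp]; simpa [eval_comp] using hβ'
    rwa [coeff_derivative, Nat.cast_zero, zero_add, zero_add, mul_one] at this
  have hFne : F ≠ 0 := by rintro h; rw [h] at hF1; simp at hF1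
  have hg1 : 1 ≤ g := by
    have : 1 ≤ F.natDegree := le_natDegree_of_ne_zero hF1
    omega
  have htr : F.natTrailingDegree = 1 :=
    le_antisymm (natTrailingDegree_le_of_ne_zero hF1)
      (Nat.one_le_iff_ne_zero.mpr fun h => by
        rw [natTrailingDegree_eq_zero] at h
        exact h.elim hFne fun h => h hF0)
  have hrev : F.reverse.natDegree = 2 * (g - 1) + 1 := by
    rw [reverse_natDegree, htr, hFdeg]; omega
  have b := abs_sum_quadraticChar_eval_le_of_odd p hQ hK hrev (by omega)
  have hsum : ∑ x : K, quadraticChar K (f.eval x) =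
      ∑ x : K, quadraticChar K (F.reverse.eval x) - quadraticChar K (F.reverse.eval 0) := by
    have e1 : ∑ x : K, quadraticChar K (f.eval x) = ∑ x : K, quadraticChar K (F.eval x) := by
      rw [← Equiv.sum_comp (Equiv.addRight β)]
      simp [hF, eval_comp]
    have e2 : ∑ x : K, quadraticChar K (F.eval x) = ∑ x : K, quadraticChar K (F.eval x⁻¹) :=
      (Equiv.sum_comp (Equiv.inv K) fun x => quadraticChar K (F.eval x)).symm
    rw [e1, e2, eq_sub_iff_add_eq, ← Finset.sum_erase_add _ _ (Finset.mem_univ (0 : K)),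
      ← Finset.sum_erase_add Finset.univ (fun x => quadraticChar K (F.reverse.eval x))
        (Finset.mem_univ (0 : K))]
    have e3 : F.eval (0 : K)⁻¹ = 0 := by rw [inv_zero, ← coeff_zero_eq_eval_zero, hF0]
    rw [e3, quadraticChar_zero, add_zero]
    congr 1
    refine Finset.sum_congr rfl fun x hx => ?_
    have hx0 : x ≠ 0 := Finset.ne_of_mem_erase hx
    have hxi : x⁻¹ ≠ 0 := inv_ne_zero hx0
    let := invertibleOfNonzero hxi
    have e4 := eval₂_reverse_mul_pow (RingHom.id K) x⁻¹ F
    rw [invOf_eq_inv, inv_inv, hFdeg, hg] at e4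
    have e5 : F.eval x⁻¹ = F.reverse.eval x * ((x⁻¹) ^ g) ^ 2 := by
      rw [← pow_mul, mul_comm g 2]; exact e4.symm
    rw [e5, map_mul, quadraticChar_sq_one' (pow_ne_zero _ hxi), mul_one]
  rw [hsum]
  have b3 : |quadraticChar K (F.reverse.eval 0)| ≤ 1 := by
    rcases eq_or_ne (F.reverse.eval 0) 0 with h0 | h0
    · simp [h0]
    · rcases quadraticChar_dichotomy h0 with h | h <;> rw [h] <;> norm_num
  refine (abs_sub _ _).trans ?_
  rw [hg]
  push_cast [Nat.cast_sub hg1] at b ⊢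
  nlinarith

end Bombieri

section QuadraticCharacter

/-- The quadratic character of a finite extension is the quadratic character of the norm. -/
lemma quadraticChar_eq_quadraticChar_norm {F E : Type*} [Field F] [Fintype F] [DecidableEq F]
    [Field E] [Fintype E] [DecidableEq E] [Algebra F E] (hF : ringChar F ≠ 2) (z : E) :
    quadraticChar E z = quadraticChar F (Algebra.norm F z) := by
  have hE : ringChar E ≠ 2 := by
    have := Algebra.ringChar_eq F E
    rwa [← this]
  rcases eq_or_ne z 0 with rfl | hz
  · rw [Algebra.norm_zero, quadraticChar_zero, quadraticChar_zero]
  have hN : Algebra.norm F z ≠ 0 := Algebra.norm_ne_zero_iff.mpr hz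
  have hiff : IsSquare z ↔ IsSquare (Algebra.norm F z) := by
    rw [FiniteField.isSquare_iff hE hz, FiniteField.isSquare_iff hF hN,
      ← (algebraMap F E).injective.eq_iff, map_pow, map_one, FiniteField.algebraMap_norm_eq_pow,
      ← pow_mul, Nat.card_eq_fintype_card, Nat.card_eq_fintype_card]
    have h1 : Fintype.card E % 2 = 1 := FiniteField.odd_card_of_char_ne_two hE
    have h2 : Fintype.card F % 2 = 1 := FiniteField.odd_card_of_char_ne_two hF
    have h3 : Fintype.card F - 1 ∣ Fintype.card E - 1 := by
      rw [Module.card_eq_pow_finrank (K := F) (V := E)]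
      exact Nat.sub_one_dvd_pow_sub_one _ _
    obtain ⟨c, hc⟩ := h3
    have h4 : 0 < Fintype.card F - 1 := Nat.sub_pos_of_lt Fintype.one_lt_card
    rw [hc, Nat.mul_div_cancel_left _ h4]
    have h5 : Fintype.card E / 2 = c * (Fintype.card F / 2) := by
      obtain ⟨a, ha⟩ : ∃ a, Fintype.card E = 2 * a + 1 := ⟨Fintype.card E / 2, by omega⟩
      obtain ⟨b, hb⟩ : ∃ b, Fintype.card F = 2 * b + 1 := ⟨Fintype.card F / 2, by omega⟩
      rw [ha, hb] at hc ⊢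
      have e1 : (2 * a + 1) / 2 = a := by omega
      have e2 : (2 * b + 1) / 2 = b := by omega
      simp only [Nat.add_sub_cancel] at hc
      rw [e1, e2]
      have : 2 * a = 2 * (c * b) := by rw [hc]; ring
      omega
    rw [h5]
  by_cases hs : IsSquare z
  · rw [(quadraticChar_one_iff_isSquare hz).mpr hs,
      (quadraticChar_one_iff_isSquare hN).mpr (hiff.mp hs)]
  · rw [quadraticChar_neg_one_iff_not_isSquare.mpr hs,
      quadraticChar_neg_one_iff_not_isSquare.mpr (hiff.not.mp hs)]

variable {F : Type} [Field F]

lemma legSym_eq_quadraticChar {E : Type*} [Field E] [Fintype E] [DecidableEq E] {p : F[X]}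
    (φ : F[X] →+* E) (hφ : Function.Surjective φ) (hker : ∀ g, φ g = 0 ↔ p ∣ g) (d : F[X]) :
    legSym d p = quadraticChar E (φ d) := by
  rw [legSym]
  split_ifs with h1 h2
  · rw [(hker d).mpr h1, quadraticChar_zero]
  · obtain ⟨a, ha, had⟩ := h2
    rw [eq_comm, quadraticChar_one_iff_isSquare (mt (hker d).mp h1)]
    refine ⟨φ a, ?_⟩
    have := (hker _).mpr had
    rw [map_sub, map_pow, sub_eq_zero] at this
    rw [← this, pow_two]
  · rw [eq_comm, quadraticChar_neg_one_iff_not_isSquare]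
    rintro ⟨b, hb⟩
    obtain ⟨a, rfl⟩ := hφ b
    refine h2 ⟨a, fun ha => h1 ?_, ?_⟩
    · rw [← hker, hb, (hker a).mpr ha, mul_zero]
    · rw [← hker, map_sub, map_pow, hb, pow_two, sub_self]

variable [Fintype F]

lemma algebraMap_norm_mk_eq_resultant {p : F[X]} (hp : p.Monic) [Fact (Irreducible p)]
    (d : F[X]) : Algebra.norm F (AdjoinRoot.mk p d) = resultant p d := by
  have hirr : Irreducible p := Fact.out
  have : FiniteDimensional F (AdjoinRoot p) := (AdjoinRoot.powerBasis hirr.ne_zero).finite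
  let Ω := AlgebraicClosure F
  apply (algebraMap F Ω).injective
  rw [Algebra.norm_eq_prod_embeddings]
  have hsplit : (p.map (algebraMap F Ω)).Splits := IsAlgClosed.splits _
  have hres := resultant_eq_prod_eval (p.map (algebraMap F Ω)) (d.map (algebraMap F Ω))
    d.natDegree natDegree_map_le hsplit
  rw [natDegree_map, resultant_map_map, (hp.map _).leadingCoeff, one_pow, one_mul] at hres
  rw [hres]
  have hnodup : (p.aroots Ω).Nodup :=
    nodup_roots (Separable.map (PerfectField.separable_of_irreducible hirr))
  classical
  let := Fintype.ofEquiv _ (AdjoinRoot.equiv Ω F p hirr.ne_zero)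
  rw [Fintype.prod_equiv (AdjoinRoot.equiv Ω F p hirr.ne_zero)
    (fun σ => σ (AdjoinRoot.mk p d)) (fun x => (d.map (algebraMap F Ω)).eval x.1)]
  · rw [← Finset.prod_subtype (p.aroots Ω).toFinset (fun _ => Multiset.mem_toFinset)
      (fun x => (d.map (algebraMap F Ω)).eval x), Finset.prod_eq_multiset_prod,
      Multiset.toFinset_val, Multiset.dedup_eq_self.mpr hnodup]
  · intro σ
    have e : (AdjoinRoot.equiv Ω F p hirr.ne_zero σ).1 = σ (AdjoinRoot.root p) := rfl
    rw [e, eval_map_algebraMap, ← AdjoinRoot.aeval_eq, aeval_algHom_apply]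

lemma legSym_eq_quadraticChar_resultant [DecidableEq F] (hF : ringChar F ≠ 2) {p : F[X]}
    (hp : p.Monic) (hirr : Irreducible p) (d : F[X]) :
    legSym d p = quadraticChar F (resultant p d) := by
  classical
  have : Fact (Irreducible p) := ⟨hirr⟩
  have : FiniteDimensional F (AdjoinRoot p) := (AdjoinRoot.powerBasis hirr.ne_zero).finite
  have : Finite (AdjoinRoot p) := Module.finite_of_finite F
  let := Fintype.ofFinite (AdjoinRoot p)
  rw [legSym_eq_quadraticChar (AdjoinRoot.mk p) AdjoinRoot.mk_surjective
    (fun g => AdjoinRoot.mk_eq_zero), quadraticChar_eq_quadraticChar_norm hF,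
    algebraMap_norm_mk_eq_resultant hp]

omit [Fintype F] in
lemma quadChar_one (d : F[X]) : quadChar d 1 = 1 := by
  classical
  simp [quadChar]

omit [Fintype F] in
lemma quadChar_mul (d : F[X]) {m n : F[X]} (hm : m ≠ 0) (hn : n ≠ 0) :
    quadChar d (m * n) = quadChar d m * quadChar d n := by
  classical
  rw [quadChar, UniqueFactorizationMonoid.normalizedFactors_mul hm hn, Multiset.map_add,
    Multiset.prod_add, quadChar, quadChar]

omit [Fintype F] in
lemma quadChar_pow (d : F[X]) {m : F[X]} (hm : m ≠ 0) (k : ℕ) :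
    quadChar d (m ^ k) = quadChar d m ^ k := by
  induction k with
  | zero => simp [quadChar_one]
  | succ k ih => rw [pow_succ, quadChar_mul d (pow_ne_zero _ hm) hm, ih, pow_succ]

omit [Fintype F] in
lemma quadChar_of_irreducible (d : F[X]) {p : F[X]} (hp : p.Monic) (hirr : Irreducible p) :
    quadChar d p = legSym d p := by
  classical
  rw [quadChar, UniqueFactorizationMonoid.normalizedFactors_irreducible hirr,
    hp.normalize_eq_self]
  simp

omit [Fintype F] in
/-- Induction over monic polynomials by multiplication with monic irreducible ones. -/
lemma monic_induction {P : F[X] → Prop} (h1 : P 1)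
    (hmul : ∀ p m : F[X], p.Monic → Irreducible p → m.Monic → P m → P (p * m)) {m : F[X]}
    (hm : m.Monic) : P m := by
  induction hn : m.natDegree using Nat.strong_induction_on generalizing m with
  | _ n ih =>
    rcases Nat.eq_zero_or_pos m.natDegree with h0 | h0
    · rwa [hm.natDegree_eq_zero.mp h0]
    · obtain ⟨p, hp, hirr, k, rfl⟩ : ∃ p : F[X], p.Monic ∧ Irreducible p ∧ p ∣ m :=
        Polynomial.exists_monic_irreducible_factor m
          (fun hu => h0.ne' (natDegree_eq_zero_of_isUnit hu))
      have hk := hp.of_mul_monic_left hm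
      refine hmul p k hp hirr hk (ih _ ?_ hk rfl)
      rw [← hn, hp.natDegree_mul hk]
      have := hirr.natDegree_pos
      omega

lemma quadChar_eq_quadraticChar_resultant [DecidableEq F] (hF : ringChar F ≠ 2) {m : F[X]}
    (hm : m.Monic) (d : F[X]) : quadChar d m = quadraticChar F (resultant m d) := by
  refine monic_induction (P := fun m => quadChar d m = quadraticChar F (resultant m d)) ?_ ?_ hm
  · simp [quadChar_one]
  · intro p m hp hirr hm ih
    rw [quadChar_mul d hp.ne_zero hm.ne_zero, quadChar_of_irreducible d hp hirr, ih,
      legSym_eq_quadraticChar_resultant hF hp hirr, hp.natDegree_mul hm,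
      resultant_mul_left _ _ _ _ le_rfl, map_mul]

/-- Quadratic reciprocity over a finite field in which `-1` is a square. -/
lemma quadChar_eq_quadraticChar_resultant_swap [DecidableEq F] (h4 : Fintype.card F % 4 = 1)
    {m : F[X]} (hm : m.Monic) (d : F[X]) : quadChar d m = quadraticChar F (resultant d m) := by
  have hF : ringChar F ≠ 2 := fun h => by
    have := FiniteField.even_card_of_char_two h
    omega
  have hneg : quadraticChar F (-1) = 1 := by
    rw [quadraticChar_one_iff_isSquare (neg_ne_zero.mpr one_ne_zero),
      FiniteField.isSquare_neg_one_iff]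
    omega
  rw [quadChar_eq_quadraticChar_resultant hF hm, resultant_comm, map_mul, map_pow, hneg, one_pow,
    one_mul]

end QuadraticCharacter

section Reciprocity

variable {F : Type} [Field F] [Fintype F]

lemma exists_quadraticChar_mk_eq_legSym {p : F[X]} (hirr : Irreducible p) :
    ∃ (E : Type) (_ : Field E) (_ : Fintype E) (_ : DecidableEq E) (φ : F[X] →+* E),
      Function.Surjective φ ∧ (∀ g, φ g = 0 ↔ p ∣ g) ∧ Fintype.card E = Fintype.card F ^ p.natDegree
      ∧ ∀ g, legSym g p = quadraticChar E (φ g) := by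
  classical
  have : Fact (Irreducible p) := ⟨hirr⟩
  have : FiniteDimensional F (AdjoinRoot p) := (AdjoinRoot.powerBasis hirr.ne_zero).finite
  have : Finite (AdjoinRoot p) := Module.finite_of_finite F
  let := Fintype.ofFinite (AdjoinRoot p)
  have hker : ∀ g, AdjoinRoot.mk p g = 0 ↔ p ∣ g := fun g => AdjoinRoot.mk_eq_zero
  refine ⟨AdjoinRoot p, inferInstance, inferInstance, inferInstance, AdjoinRoot.mk p,
    AdjoinRoot.mk_surjective, hker, ?_, legSym_eq_quadraticChar _ AdjoinRoot.mk_surjective hker⟩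
  rw [Module.card_eq_pow_finrank (K := F) (V := AdjoinRoot p),
    (AdjoinRoot.powerBasis hirr.ne_zero).finrank, AdjoinRoot.powerBasis_dim]

lemma legSym_mul {p : F[X]} (hirr : Irreducible p) (g h : F[X]) :
    legSym (g * h) p = legSym g p * legSym h p := by
  obtain ⟨E, _, _, _, φ, -, -, -, h'⟩ := exists_quadraticChar_mk_eq_legSym hirr
  simp only [h', map_mul]

lemma legSym_congr {p g h : F[X]} (hirr : Irreducible p) (hgh : p ∣ g - h) :
    legSym g p = legSym h p := by
  obtain ⟨E, _, _, _, φ, -, hker, -, h'⟩ := exists_quadraticChar_mk_eq_legSym hirr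
  rw [h', h', sub_eq_zero.mp (by rw [← map_sub, hker]; exact hgh : φ g - φ h = 0)]

lemma exists_legSym_eq_neg_one (hF : ringChar F ≠ 2) {p : F[X]} (hirr : Irreducible p) :
    ∃ g, legSym g p = -1 := by
  obtain ⟨E, _, _, _, φ, hφ, -, hcard, h'⟩ := exists_quadraticChar_mk_eq_legSym hirr
  have hE : ringChar E ≠ 2 := by
    intro h
    have h1 := FiniteField.even_card_of_char_two h
    have h2 : Odd (Fintype.card F ^ p.natDegree) :=
      (Nat.odd_iff.mpr (FiniteField.odd_card_of_char_ne_two hF)).pow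
    rw [← hcard, Nat.odd_iff] at h2
    omega
  obtain ⟨b, hb⟩ := quadraticChar_exists_neg_one hE
  obtain ⟨a, rfl⟩ := hφ b
  exact ⟨a, by rw [h', hb]⟩

lemma quadChar_mul_left (g h m : F[X]) :
    quadChar (g * h) m = quadChar g m * quadChar h m := by
  classical
  rw [quadChar, quadChar, quadChar, ← Multiset.prod_map_mul]
  refine congrArg _ (Multiset.map_congr rfl fun p hp => legSym_mul ?_ g h)
  exact UniqueFactorizationMonoid.irreducible_of_normalized_factor p hp

lemma quadChar_congr_left {g h m : F[X]} (hgh : m ∣ g - h) : quadChar g m = quadChar h m := by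
  classical
  rw [quadChar, quadChar]
  refine congrArg _ (Multiset.map_congr rfl fun p hp => legSym_congr ?_ ?_)
  · exact UniqueFactorizationMonoid.irreducible_of_normalized_factor p hp
  · exact (UniqueFactorizationMonoid.dvd_of_mem_normalizedFactors hp).trans hgh

omit [Fintype F] in
lemma quadChar_one_left (m : F[X]) : quadChar 1 m = 1 := by
  classical
  rw [quadChar]
  refine Multiset.prod_eq_one fun x hx => ?_
  obtain ⟨p, hp, rfl⟩ := Multiset.mem_map.mp hx
  have hu : ¬ p ∣ 1 := fun h =>
    (UniqueFactorizationMonoid.irreducible_of_normalized_factor p hp).not_isUnit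
      (isUnit_of_dvd_one h)
  rw [legSym, if_neg hu, if_pos ⟨1, hu, by simp⟩]

lemma ringChar_ne_two_of_card (h4 : Fintype.card F % 4 = 1) : ringChar F ≠ 2 := fun h => by
  have := FiniteField.even_card_of_char_two h
  omega

lemma quadChar_reciprocity (h4 : Fintype.card F % 4 = 1) {d m : F[X]} (hd : d.Monic)
    (hm : m.Monic) : quadChar d m = quadChar m d := by
  classical
  rw [quadChar_eq_quadraticChar_resultant_swap h4 hm,
    quadChar_eq_quadraticChar_resultant (ringChar_ne_two_of_card h4) hd]

lemma exists_quadChar_eq_neg_one (hF : ringChar F ≠ 2) {d : F[X]} (hd : d.Monic)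
    (hsq : Squarefree d) (hdeg : 1 ≤ d.natDegree) : ∃ u, quadChar u d = -1 ∧ IsCoprime u d := by
  obtain ⟨p, hp, hirr, e, rfl⟩ : ∃ p : F[X], p.Monic ∧ Irreducible p ∧ p ∣ d :=
    Polynomial.exists_monic_irreducible_factor d
      (fun hu => (Nat.one_le_iff_ne_zero.mp hdeg) (natDegree_eq_zero_of_isUnit hu))
  have he := hp.of_mul_monic_left hd
  have hcop : IsCoprime p e := (IsRelPrime.of_squarefree_mul hsq).isCoprime
  obtain ⟨a, ha⟩ := exists_legSym_eq_neg_one hF hirr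
  obtain ⟨s, t, hst⟩ := hcop
  have hap : IsCoprime a p := by
    rw [isCoprime_comm, hirr.coprime_iff_not_dvd]
    intro h
    rw [legSym, if_pos h] at ha
    omega
  have h1 : p ∣ a * (t * e) + s * p - a := ⟨s * (1 - a), by linear_combination a * hst⟩
  have h2 : e ∣ a * (t * e) + s * p - 1 := ⟨t * (a - 1), by linear_combination hst⟩
  refine ⟨a * (t * e) + s * p, ?_, ?_⟩
  · rw [quadChar_mul _ hp.ne_zero he.ne_zero, quadChar_of_irreducible _ hp hirr,
      legSym_congr hirr h1, ha, quadChar_congr_left h2, quadChar_one_left, mul_one]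
  · refine IsCoprime.mul_right ?_ ?_
    · obtain ⟨c, hc⟩ := h1
      rw [show a * (t * e) + s * p = a + p * c by linear_combination hc]
      exact hap.add_mul_left_left c
    · obtain ⟨c, hc⟩ := h2
      rw [show a * (t * e) + s * p = 1 + e * c by linear_combination hc]
      exact isCoprime_one_left.add_mul_left_left c

end Reciprocity

section CharacterSum

variable {F : Type} [Field F]

lemma monicOf_eq (n : ℕ) (a : Fin n → F) :
    monicOf n a = X ^ n + ∑ i : Fin n, C (a i) * X ^ (i : ℕ) :=
  rfl

lemma monicOf_monic (n : ℕ) (a : Fin n → F) : (monicOf n a).Monic :=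
  monic_X_pow_add (degree_sum_fin_lt a)

lemma natDegree_monicOf (n : ℕ) (a : Fin n → F) : (monicOf n a).natDegree = n := by
  rw [monicOf_eq, natDegree_add_eq_left_of_degree_lt, natDegree_X_pow]
  rw [degree_X_pow]
  exact degree_sum_fin_lt a

lemma monicOf_injective (n : ℕ) : Function.Injective (monicOf n : (Fin n → F) → F[X]) := by
  intro a b hab
  funext i
  have := congrArg (fun f : F[X] => f.coeff i) hab
  simpa [monicOf_eq, coeff_X_pow, coeff_C_mul, finsetSum_coeff, Fin.val_inj] using this

lemma monicOf_surj {n : ℕ} {m : F[X]} (hm : m.Monic) (hn : m.natDegree = n) :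
    ∃ a, monicOf n a = m := by
  refine ⟨fun i => m.coeff i, ?_⟩
  conv_rhs => rw [hm.as_sum, hn]
  rw [monicOf_eq, Finset.sum_range (fun i => C (m.coeff i) * X ^ i)]

variable [Fintype F]

/-- The finite set of monic polynomials of degree `n` over a finite field. -/
noncomputable def monicsOfDegree (F : Type) [Field F] [Fintype F] (n : ℕ) : Finset F[X] :=
  Finset.univ.map ⟨monicOf n, monicOf_injective n⟩

lemma mem_monicsOfDegree {n : ℕ} {m : F[X]} :
    m ∈ monicsOfDegree F n ↔ m.Monic ∧ m.natDegree = n := by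
  simp only [monicsOfDegree, Finset.mem_map, Finset.mem_univ, true_and,
    Function.Embedding.coeFn_mk]
  constructor
  · rintro ⟨a, rfl⟩
    exact ⟨monicOf_monic n a, natDegree_monicOf n a⟩
  · rintro ⟨hm, hn⟩
    exact monicOf_surj hm hn

/-- The `n`-th coefficient `∑ χ_d(m)`, over monic `m` of degree `n`, of the `L`-function. -/
noncomputable def charSum (d : F[X]) (n : ℕ) : ℤ := ∑ m ∈ monicsOfDegree F n, quadChar d m

lemma sum_quadChar_monicOf (d : F[X]) (n : ℕ) :
    ∑ a : Fin n → F, quadChar d (monicOf n a) = charSum d n := by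
  simp [charSum, monicsOfDegree]

lemma charSum_zero (d : F[X]) : charSum d 0 = 1 := by
  rw [← sum_quadChar_monicOf]
  simp [monicOf_eq, quadChar_one]

lemma charSum_eq_zero (h4 : Fintype.card F % 4 = 1) {d : F[X]} (hd : d.Monic)
    (hsq : Squarefree d) (hdeg : 1 ≤ d.natDegree) {n : ℕ} (hn : d.natDegree ≤ n) :
    charSum d n = 0 := by
  classical
  obtain ⟨u, hu, hcop⟩ := exists_quadChar_eq_neg_one (ringChar_ne_two_of_card h4) hd hsq hdeg
  have hd1 : d ≠ 1 := by
    rintro rfl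
    simp at hdeg
  let σ : F[X] → F[X] := fun m => d * (m /ₘ d) + (u * m) %ₘ d
  have hσ : ∀ m ∈ monicsOfDegree F n, σ m ∈ monicsOfDegree F n := by
    intro m hm
    rw [mem_monicsOfDegree] at hm ⊢
    have hle : d.degree ≤ m.degree := by
      rw [degree_eq_natDegree hd.ne_zero, degree_eq_natDegree hm.1.ne_zero, hm.2]
      exact_mod_cast hn
    have hmon : (d * (m /ₘ d)).Monic := by
      refine hd.mul ?_
      rw [Monic, leadingCoeff_divByMonic_of_monic hd hle, hm.1]
    have hnat : (d * (m /ₘ d)).natDegree = n := by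
      rw [hd.natDegree_mul', natDegree_divByMonic m hd, hm.2]
      · omega
      · rw [Ne, divByMonic_eq_zero_iff hd]
        exact hle.not_gt
    have hlt : ((u * m) %ₘ d).degree < (d * (m /ₘ d)).degree := by
      refine (degree_modByMonic_lt _ hd).trans_le ?_
      rw [degree_eq_natDegree hd.ne_zero, degree_eq_natDegree hmon.ne_zero, hnat]
      exact_mod_cast hn
    exact ⟨hmon.add_of_left hlt, by rw [natDegree_add_eq_left_of_degree_lt hlt, hnat]⟩
  have hmod : ∀ m, d ∣ σ m - u * m := by
    intro m
    refine ⟨m /ₘ d - (u * m) /ₘ d, ?_⟩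
    simp only [σ]
    linear_combination modByMonic_add_div (u * m) d
  have hchar : ∀ m ∈ monicsOfDegree F n, quadChar d (σ m) = -quadChar d m := by
    intro m hm
    have h1 := (mem_monicsOfDegree.mp hm).1
    have h2 := (mem_monicsOfDegree.mp (hσ m hm)).1
    rw [quadChar_reciprocity h4 hd h2, quadChar_congr_left (hmod m), quadChar_mul_left, hu,
      quadChar_reciprocity h4 hd h1, neg_one_mul]
  have hdiv : ∀ m, σ m /ₘ d = m /ₘ d := fun m => by
    refine (div_modByMonic_unique (m /ₘ d) ((u * m) %ₘ d) hd ⟨?_, degree_modByMonic_lt _ hd⟩).1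
    simp only [σ]
    ring
  have hinj : Set.InjOn σ (monicsOfDegree F n) := by
    intro m _ m' _ h
    have h1 : m /ₘ d = m' /ₘ d := by rw [← hdiv m, ← hdiv m', h]
    have h2 : d ∣ m - m' := by
      refine hcop.symm.dvd_of_dvd_mul_left ?_
      have := dvd_sub (hmod m') (hmod m)
      rw [h] at this
      convert this using 1
      ring
    rw [← modByMonic_eq_zero_iff_dvd hd, sub_modByMonic, sub_eq_zero] at h2
    rw [← modByMonic_add_div m d, ← modByMonic_add_div m' d, h1, h2]
  have himg : (monicsOfDegree F n).image σ = monicsOfDegree F n :=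
    Finset.eq_of_subset_of_card_le (Finset.image_subset_iff.mpr hσ)
      (Finset.card_image_of_injOn hinj).ge
  have : charSum d n = -charSum d n := by
    conv_lhs => rw [charSum, ← himg, Finset.sum_image hinj]
    rw [Finset.sum_congr rfl hchar, Finset.sum_neg_distrib, charSum]
  omega

end CharacterSum

section Recurrence

variable {F : Type} [Field F] [Fintype F]

lemma sum_quadChar_filter_dvd (d : F[X]) {g : F[X]} (hg : g.Monic) (n : ℕ)
    [DecidablePred (g ∣ ·)] :
    ∑ m ∈ (monicsOfDegree F n).filter (g ∣ ·), quadChar d m =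
      if g.natDegree ≤ n then quadChar d g * charSum d (n - g.natDegree) else 0 := by
  split_ifs with h
  · rw [charSum, Finset.mul_sum]
    symm
    refine Finset.sum_bij (fun m _ => g * m) ?_ ?_ ?_ ?_
    · intro m hm
      rw [mem_monicsOfDegree] at hm
      rw [Finset.mem_filter, mem_monicsOfDegree]
      refine ⟨⟨hg.mul hm.1, ?_⟩, dvd_mul_right _ _⟩
      rw [hg.natDegree_mul hm.1]
      omega
    · intro a _ b _ hab
      exact mul_left_cancel₀ hg.ne_zero hab
    · intro m hm
      rw [Finset.mem_filter, mem_monicsOfDegree] at hm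
      obtain ⟨⟨hm, hn⟩, c, rfl⟩ := hm
      have hc := hg.of_mul_monic_left hm
      rw [hg.natDegree_mul hc] at hn
      exact ⟨c, mem_monicsOfDegree.mpr ⟨hc, by omega⟩, rfl⟩
    · intro m hm
      rw [quadChar_mul d hg.ne_zero (mem_monicsOfDegree.mp hm).1.ne_zero]
  · refine Finset.sum_eq_zero fun m hm => ?_
    rw [Finset.mem_filter, mem_monicsOfDegree] at hm
    exact absurd (hm.1.2 ▸ natDegree_le_of_dvd hm.2 hm.1.1.ne_zero) h

/-- The finite set of monic irreducible polynomials of degree `k` over a finite field. -/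
noncomputable def irreduciblesOfDegree (F : Type) [Field F] [Fintype F] (k : ℕ) : Finset F[X] :=
  haveI := Classical.decPred (Irreducible : F[X] → Prop)
  (monicsOfDegree F k).filter Irreducible

lemma mem_irreduciblesOfDegree {k : ℕ} {p : F[X]} :
    p ∈ irreduciblesOfDegree F k ↔ p.Monic ∧ Irreducible p ∧ p.natDegree = k := by
  classical
  rw [irreduciblesOfDegree, Finset.mem_filter, mem_monicsOfDegree]
  tauto

/-- The `i`-th coefficient `∑ deg p · χ_d(p) ^ j`, over monic irreducible `p` and `j ≥ 1` with
`j * deg p = i`, of the logarithmic derivative of the `L`-function. -/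
noncomputable def primeSum (d : F[X]) (i : ℕ) : ℤ :=
  ∑ x ∈ i.divisorsAntidiagonal, ∑ p ∈ irreduciblesOfDegree F x.1, (x.1 : ℤ) * legSym d p ^ x.2

omit [Fintype F] in
lemma count_normalizedFactors_eq_card [DecidableEq F] {p m : F[X]} (hp : p.Monic)
    (hirr : Irreducible p) (hm : m.Monic) {n : ℕ} (hn : m.natDegree = n)
    [DecidablePred fun j => p ^ j ∣ m] :
    (UniqueFactorizationMonoid.normalizedFactors m).count p =
      ((Finset.Icc 1 n).filter fun j => p ^ j ∣ m).card := by
  set c := (UniqueFactorizationMonoid.normalizedFactors m).count p with hc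
  have hiff : ∀ j, p ^ j ∣ m ↔ j ≤ c := by
    intro j
    rw [pow_dvd_iff_le_emultiplicity,
      UniqueFactorizationMonoid.le_emultiplicity_iff_replicate_le_normalizedFactors hirr
        hm.ne_zero, hp.normalize_eq_self, hc, Multiset.le_count_iff_replicate_le]
  have hcn : c ≤ n := by
    have h1 := natDegree_le_of_dvd ((hiff c).mpr le_rfl) hm.ne_zero
    rw [hp.natDegree_pow, hn] at h1
    exact (Nat.le_mul_of_pos_right c hirr.natDegree_pos).trans h1
  have : (Finset.Icc 1 n).filter (fun j => p ^ j ∣ m) = Finset.Icc 1 c := by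
    ext j
    simp only [Finset.mem_filter, Finset.mem_Icc, hiff]
    omega
  rw [this, Nat.card_Icc, Nat.add_sub_cancel]

lemma natDegree_eq_sum_irreducibles {m : F[X]} (hm : m.Monic) {n : ℕ} (hn : m.natDegree = n)
    [∀ p : F[X], DecidablePred fun j => p ^ j ∣ m] :
    n = ∑ k ∈ Finset.Icc 1 n, ∑ p ∈ irreduciblesOfDegree F k, ∑ j ∈ Finset.Icc 1 n,
      if p ^ j ∣ m then k else 0 := by
  classical
  set N := UniqueFactorizationMonoid.normalizedFactors m with hN
  have hirr : ∀ p ∈ N, Irreducible p := fun p hp =>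
    UniqueFactorizationMonoid.irreducible_of_normalized_factor p hp
  have hmon : ∀ p ∈ N, p.Monic := fun p hp => by
    rw [← UniqueFactorizationMonoid.normalize_normalized_factor p hp]
    exact monic_normalize (hirr p hp).ne_zero
  have hprod : N.prod = m := by
    rw [hN, UniqueFactorizationMonoid.prod_normalizedFactors_eq hm.ne_zero, hm.normalize_eq_self]
  have h1 : n = (N.map natDegree).sum := by
    rw [← hn, ← hprod, natDegree_multiset_prod_of_monic _ hmon]
  have h2 : ∀ k ∈ Finset.Icc 1 n, ∀ p ∈ irreduciblesOfDegree F k,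
      (∑ j ∈ Finset.Icc 1 n, if p ^ j ∣ m then k else 0) = N.count p * p.natDegree := by
    intro k _ p hp
    rw [mem_irreduciblesOfDegree] at hp
    rw [← Finset.sum_filter, Finset.sum_const, smul_eq_mul, hp.2.2,
      count_normalizedFactors_eq_card hp.1 hp.2.1 hm hn]
  rw [Finset.sum_congr rfl fun k hk => Finset.sum_congr rfl (h2 k hk), ← Finset.sum_biUnion]
  · conv_lhs => rw [h1, Finset.sum_multiset_map_count]
    simp only [smul_eq_mul]
    refine Finset.sum_subset ?_ ?_
    · intro p hp
      rw [Multiset.mem_toFinset] at hp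
      rw [Finset.mem_biUnion]
      refine ⟨p.natDegree, ?_, mem_irreduciblesOfDegree.mpr ⟨hmon p hp, hirr p hp, rfl⟩⟩
      rw [Finset.mem_Icc]
      refine ⟨(hirr p hp).natDegree_pos, ?_⟩
      rw [← hn]
      exact natDegree_le_of_dvd (UniqueFactorizationMonoid.dvd_of_mem_normalizedFactors hp)
        hm.ne_zero
    · intro p _ hp
      rw [Multiset.mem_toFinset] at hp
      rw [Multiset.count_eq_zero_of_notMem hp, zero_mul]
  · intro a _ b _ hab
    rw [Function.onFun, Finset.disjoint_left]
    intro p hpa hpb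
    exact hab ((mem_irreduciblesOfDegree.mp hpa).2.2.symm.trans
      (mem_irreduciblesOfDegree.mp hpb).2.2)

lemma mul_charSum (d : F[X]) (n : ℕ) :
    (n : ℤ) * charSum d n = ∑ i ∈ Finset.Icc 1 n, primeSum d i * charSum d (n - i) := by
  classical
  have hL : (n : ℤ) * charSum d n =
      ∑ x ∈ Finset.Icc 1 n ×ˢ Finset.Icc 1 n, if x.1 * x.2 ≤ n then
        (∑ p ∈ irreduciblesOfDegree F x.1, (x.1 : ℤ) * legSym d p ^ x.2) *
          charSum d (n - x.1 * x.2) else 0 := by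
    have e : ∀ m ∈ monicsOfDegree F n, (n : ℤ) * quadChar d m = ∑ k ∈ Finset.Icc 1 n,
        ∑ p ∈ irreduciblesOfDegree F k, ∑ j ∈ Finset.Icc 1 n,
          if p ^ j ∣ m then (k : ℤ) * quadChar d m else 0 := by
      intro m hm
      rw [mem_monicsOfDegree] at hm
      conv_lhs => rw [natDegree_eq_sum_irreducibles hm.1 hm.2]
      push_cast
      simp only [Finset.sum_mul, ite_mul, zero_mul]
    rw [charSum, Finset.mul_sum, Finset.sum_congr rfl e, Finset.sum_comm, Finset.sum_product]
    refine Finset.sum_congr rfl fun k _ => ?_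
    rw [Finset.sum_comm]
    rw [Finset.sum_congr rfl fun p _ => Finset.sum_comm, Finset.sum_comm]
    refine Finset.sum_congr rfl fun j _ => ?_
    have e2 : ∀ p ∈ irreduciblesOfDegree F k,
        (∑ m ∈ monicsOfDegree F n, if p ^ j ∣ m then (k : ℤ) * quadChar d m else 0) =
          if k * j ≤ n then (k : ℤ) * legSym d p ^ j * charSum d (n - k * j) else 0 := by
      intro p hp
      rw [mem_irreduciblesOfDegree] at hp
      rw [← Finset.sum_filter, ← Finset.mul_sum, sum_quadChar_filter_dvd d (hp.1.pow j),
        hp.1.natDegree_pow, hp.2.2, mul_comm j k, quadChar_pow d hp.1.ne_zero,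
        quadChar_of_irreducible d hp.1 hp.2.1, mul_ite, mul_zero, mul_assoc]
    rw [Finset.sum_congr rfl e2]
    split_ifs
    · rw [Finset.sum_mul]
    · rw [Finset.sum_const_zero]
  rw [hL, ← Finset.sum_filter, ← Finset.sum_fiberwise_of_maps_to (t := Finset.Icc 1 n)
    (g := fun x => x.1 * x.2)]
  · refine Finset.sum_congr rfl fun i hi => ?_
    rw [primeSum, Finset.sum_mul]
    have hset : ((Finset.Icc 1 n ×ˢ Finset.Icc 1 n).filter (fun x => x.1 * x.2 ≤ n)).filter
        (fun x => x.1 * x.2 = i) = i.divisorsAntidiagonal := by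
      ext ⟨a, b⟩
      rw [Finset.mem_Icc] at hi
      simp only [Finset.mem_filter, Finset.mem_product, Finset.mem_Icc,
        Nat.mem_divisorsAntidiagonal]
      constructor
      · rintro ⟨-, rfl⟩
        exact ⟨rfl, by omega⟩
      · rintro ⟨rfl, h0⟩
        have ha : 0 < a := Nat.pos_of_ne_zero fun h => h0 (by simp [h])
        have hb : 0 < b := Nat.pos_of_ne_zero fun h => h0 (by simp [h])
        have h1 := Nat.le_mul_of_pos_right a hb
        have h2 := Nat.le_mul_of_pos_left b ha
        omega
    rw [hset]
    refine Finset.sum_congr rfl fun x hx => ?_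
    rw [(Nat.mem_divisorsAntidiagonal.mp hx).1]
  · rintro ⟨a, b⟩ hx
    simp only [Finset.mem_filter, Finset.mem_product, Finset.mem_Icc] at hx ⊢
    exact ⟨Nat.mul_pos hx.1.1.1 hx.1.2.1, hx.2⟩

end Recurrence

section PointSum

variable {F : Type} [Field F] [Fintype F] {K : Type*} [Field K] [Fintype K] [Algebra F K]

lemma quadraticChar_aeval_eq_legSym_pow [DecidableEq K] (hF : ringChar F ≠ 2) {p : F[X]}
    (hirr : Irreducible p) {x : K} (hx : aeval x p = 0) (d : F[X]) :
    quadraticChar K (aeval x d) = legSym d p ^ (Module.finrank F K / p.natDegree) := by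
  classical
  have : Fact (Irreducible p) := ⟨hirr⟩
  have : FiniteDimensional F (AdjoinRoot p) := (AdjoinRoot.powerBasis hirr.ne_zero).finite
  have : Finite (AdjoinRoot p) := Module.finite_of_finite F
  let := Fintype.ofFinite (AdjoinRoot p)
  let ψ : AdjoinRoot p →ₐ[F] K := AdjoinRoot.liftAlgHom p (Algebra.ofId F K) x hx
  let := ψ.toRingHom.toAlgebra
  have : IsScalarTower F (AdjoinRoot p) K := IsScalarTower.of_algHom ψ
  have hdeg : Module.finrank F (AdjoinRoot p) = p.natDegree := by
    rw [(AdjoinRoot.powerBasis hirr.ne_zero).finrank, AdjoinRoot.powerBasis_dim]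
  have hfin : Module.finrank (AdjoinRoot p) K = Module.finrank F K / p.natDegree := by
    rw [← Module.finrank_mul_finrank F (AdjoinRoot p) K, hdeg,
      Nat.mul_div_cancel_left _ hirr.natDegree_pos]
  have hval : aeval x d = algebraMap (AdjoinRoot p) K (AdjoinRoot.mk p d) :=
    (AdjoinRoot.liftAlgHom_mk p (Algebra.ofId F K) x hx d).symm
  have hE : ringChar (AdjoinRoot p) ≠ 2 := by
    rwa [← Algebra.ringChar_eq F (AdjoinRoot p)]
  rw [hval, quadraticChar_eq_quadraticChar_norm hE, Algebra.norm_algebraMap, map_pow, hfin,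
    legSym_eq_quadraticChar (AdjoinRoot.mk p) AdjoinRoot.mk_surjective
      (fun g => AdjoinRoot.mk_eq_zero)]

lemma card_filter_minpoly_eq [DecidableEq F[X]] {p : F[X]} (hp : p.Monic) (hirr : Irreducible p)
    (hdvd : p.natDegree ∣ Module.finrank F K) :
    (Finset.univ.filter fun x : K => minpoly F x = p).card = p.natDegree := by
  classical
  have : Fact (Irreducible p) := ⟨hirr⟩
  have hdeg : Module.finrank F (AdjoinRoot p) = p.natDegree := by
    rw [(AdjoinRoot.powerBasis hirr.ne_zero).finrank, AdjoinRoot.powerBasis_dim]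
  obtain ⟨ψ⟩ := FiniteField.nonempty_algHom_of_finrank_dvd (F := F) (K := AdjoinRoot p) (L := K)
    (hdeg ▸ hdvd)
  have hroot : aeval (ψ (AdjoinRoot.root p)) p = 0 := by
    rw [aeval_algHom_apply, AdjoinRoot.aeval_eq, AdjoinRoot.mk_self, map_zero]
  have hsplit : (p.map (algebraMap F K)).Splits := by
    rw [minpoly.eq_of_irreducible_of_monic hirr hroot hp]
    exact Normal.splits inferInstance _
  rw [← card_rootSet_eq_natDegree (PerfectField.separable_of_irreducible hirr) hsplit,
    Fintype.card_subtype]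
  congr 1
  ext x
  simp only [Finset.mem_filter, Finset.mem_univ, true_and, mem_rootSet, ne_eq, hp.ne_zero,
    not_false_eq_true]
  constructor
  · rintro rfl
    exact minpoly.aeval F x
  · intro hx
    exact (minpoly.eq_of_irreducible_of_monic hirr hx hp).symm

lemma sum_quadraticChar_aeval [DecidableEq K] (hF : ringChar F ≠ 2) (d : F[X]) :
    ∑ x : K, quadraticChar K (aeval x d) = primeSum d (Module.finrank F K) := by
  classical
  set i := Module.finrank F K with hi
  have hi0 : 0 < i := Module.finrank_pos
  have hmaps : ∀ x ∈ (Finset.univ : Finset K), minpoly F x ∈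
      i.divisorsAntidiagonal.biUnion fun y => irreduciblesOfDegree F y.1 := by
    intro x _
    have hx_int : IsIntegral F x := Algebra.IsIntegral.isIntegral x
    obtain ⟨c, hc⟩ := minpoly.degree_dvd (K := F) hx_int
    rw [Finset.mem_biUnion]
    exact ⟨((minpoly F x).natDegree, c), Nat.mem_divisorsAntidiagonal.mpr ⟨hc.symm, hi0.ne'⟩,
      mem_irreduciblesOfDegree.mpr ⟨minpoly.monic hx_int, minpoly.irreducible hx_int, rfl⟩⟩
  rw [← Finset.sum_fiberwise_of_maps_to hmaps, Finset.sum_biUnion, primeSum]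
  · refine Finset.sum_congr rfl fun y hy => Finset.sum_congr rfl fun p hp => ?_
    rw [mem_irreduciblesOfDegree] at hp
    rw [Nat.mem_divisorsAntidiagonal] at hy
    have hval : ∀ x ∈ Finset.univ.filter (fun x : K => minpoly F x = p),
        quadraticChar K (aeval x d) = legSym d p ^ y.2 := by
      intro x hx
      have hx' : aeval x p = 0 := by
        rw [← (Finset.mem_filter.mp hx).2]
        exact minpoly.aeval F x
      have hdiv : Module.finrank F K / p.natDegree = y.2 := by
        rw [← hi, ← hy.1, ← hp.2.2, Nat.mul_div_cancel_left _ hp.2.1.natDegree_pos]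
      rw [quadraticChar_aeval_eq_legSym_pow hF hp.2.1 hx', hdiv]
    rw [Finset.sum_congr rfl hval, Finset.sum_const, card_filter_minpoly_eq hp.1 hp.2.1
      (hp.2.2 ▸ ⟨y.2, hy.1.symm⟩), hp.2.2, nsmul_eq_mul]
  · intro a ha b hb hab
    rw [Function.onFun, Finset.disjoint_left]
    intro p hpa hpb
    have h1 : a.1 = b.1 := (mem_irreduciblesOfDegree.mp hpa).2.2.symm.trans
      (mem_irreduciblesOfDegree.mp hpb).2.2
    rw [Finset.mem_coe, Nat.mem_divisorsAntidiagonal] at ha hb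
    refine hab (Prod.ext h1 ?_)
    have h2 : a.1 * a.2 = a.1 * b.2 := by rw [ha.1, h1, hb.1]
    exact Nat.eq_of_mul_eq_mul_left
      (Nat.pos_of_ne_zero fun h => ha.2 (by rw [← ha.1, h, zero_mul])) h2

end PointSum

section PointSumBounds

variable {F : Type} [Field F] [Fintype F]

variable (F) in
lemma exists_field_extension {n : ℕ} (hn : n ≠ 0) :
    ∃ (K : Type) (_ : Field K) (_ : Fintype K) (_ : DecidableEq K) (_ : Algebra F K),
      Module.finrank F K = n := by
  classical
  have : Fact (ringChar F).Prime := ⟨CharP.char_is_prime F _⟩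
  have : NeZero n := ⟨hn⟩
  exact ⟨FiniteField.Extension F (ringChar F) n, inferInstance, Fintype.ofFinite _, inferInstance,
    inferInstance, FiniteField.finrank_extension F (ringChar F) n⟩

lemma abs_quadraticChar_le_one {K : Type*} [Field K] [Fintype K] [DecidableEq K] (x : K) :
    |quadraticChar K x| ≤ 1 := by
  rcases eq_or_ne x 0 with rfl | h
  · simp
  · rcases quadraticChar_dichotomy h with h | h <;> rw [h] <;> norm_num

lemma abs_primeSum_le (hF : ringChar F ≠ 2) (d : F[X]) {n : ℕ} (hn : n ≠ 0) :
    |primeSum d n| ≤ (Fintype.card F : ℤ) ^ n := by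
  obtain ⟨K, _, _, _, _, hK⟩ := exists_field_extension F hn
  rw [← hK, ← sum_quadraticChar_aeval hF]
  refine (Finset.abs_sum_le_sum_abs _ _).trans
    ((Finset.sum_le_sum fun x _ => abs_quadraticChar_le_one _).trans ?_)
  rw [Finset.sum_const, Finset.card_univ, Module.card_eq_pow_finrank (K := F) (V := K)]
  simp

/-- Square-root cancellation in the extensions of even degree divisible by a suitable integer. -/
lemma exists_abs_primeSum_le (hF : ringChar F ≠ 2) {d : F[X]} (hsq : Squarefree d)
    (hdeg : 1 ≤ d.natDegree) : ∃ r, r ≠ 0 ∧ ∀ k, k ≠ 0 →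
      |primeSum d (2 * r * k)| ≤ (d.natDegree + 1) * (Fintype.card F : ℤ) ^ (r * k) := by
  obtain ⟨p, -, hirr, hpd⟩ : ∃ p : F[X], p.Monic ∧ Irreducible p ∧ p ∣ d :=
    Polynomial.exists_monic_irreducible_factor d
      (fun hu => (Nat.one_le_iff_ne_zero.mp hdeg) (natDegree_eq_zero_of_isUnit hu))
  refine ⟨p.natDegree * (d.natDegree + 1), mul_ne_zero hirr.natDegree_pos.ne' (by omega), ?_⟩
  intro k hk
  set t := p.natDegree * (d.natDegree + 1) * k with ht
  have hpt : d.natDegree + 1 ≤ t := by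
    rw [ht, mul_right_comm]
    exact Nat.le_mul_of_pos_left _ (Nat.mul_pos hirr.natDegree_pos (Nat.pos_of_ne_zero hk))
  obtain ⟨K, _, _, _, _, hK⟩ := exists_field_extension F (n := 2 * t) (by omega)
  have hring := Algebra.ringChar_eq F K
  obtain ⟨c, hp, hc⟩ := FiniteField.card F (ringChar F)
  have : Fact (ringChar F).Prime := ⟨hp⟩
  have : CharP K (ringChar F) := hring ▸ inferInstance
  have hodd : Odd (Fintype.card F ^ t) :=
    (Nat.odd_iff.mpr (FiniteField.odd_card_of_char_ne_two hF)).pow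
  obtain ⟨h, hh⟩ := hodd
  have hQ : ringChar F ^ ((c : ℕ) * t) = 2 * h + 1 := by rw [pow_mul, ← hc, hh]
  have hcard : Fintype.card K = (2 * h + 1) ^ 2 := by
    rw [Module.card_eq_pow_finrank (K := F) (V := K), hK, ← hh, ← pow_mul, mul_comm]
  have : Fact (Irreducible p) := ⟨hirr⟩
  have hpdeg : Module.finrank F (AdjoinRoot p) = p.natDegree := by
    rw [(AdjoinRoot.powerBasis hirr.ne_zero).finrank, AdjoinRoot.powerBasis_dim]
  obtain ⟨ψ⟩ := FiniteField.nonempty_algHom_of_finrank_dvd (F := F) (K := AdjoinRoot p) (L := K)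
    (by rw [hpdeg, hK, ht]; exact ⟨2 * ((d.natDegree + 1) * k), by ring⟩)
  set β := ψ (AdjoinRoot.root p)
  have hβ : aeval β d = 0 := by
    rw [aeval_algHom_apply, AdjoinRoot.aeval_eq, AdjoinRoot.mk_eq_zero.mpr hpd, map_zero]
  have hroot : (d.map (algebraMap F K)).IsRoot β := by
    rw [IsRoot.def, eval_map_algebraMap, hβ]
  have hsimple : (d.map (algebraMap F K)).derivative.eval β ≠ 0 := by
    rw [derivative_map, eval_map_algebraMap]
    exact (PerfectField.separable_iff_squarefree.mpr hsq).aeval_derivative_ne_zero hβ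
  have hsmall : (d.map (algebraMap F K)).natDegree ≤ 2 * h := by
    rw [natDegree_map]
    have : t < Fintype.card F ^ t := Nat.lt_pow_self Fintype.one_lt_card
    omega
  have hbound := abs_sum_quadraticChar_eval_le (ringChar F) hQ hcard hroot hsimple hsmall
  simp only [eval_map_algebraMap, natDegree_map] at hbound
  rw [sum_quadraticChar_aeval hF, hK, ht, ← mul_assoc, ← mul_assoc] at hbound
  have hh' : (2 * (h : ℤ) + 1) = (Fintype.card F : ℤ) ^ t := by exact_mod_cast hh.symm
  rw [hh'] at hbound
  rwa [← mul_assoc]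

end PointSumBounds

section InverseRoots

lemma exists_eq_prod_one_sub (P : ℂ[X]) (h0 : P.coeff 0 = 1) :
    ∃ α : Fin P.natDegree → ℂ, P = ∏ i, (1 - C (α i) * X) := by
  induction hn : P.natDegree generalizing P with
  | zero =>
    refine ⟨Fin.elim0, ?_⟩
    rw [eq_C_of_natDegree_eq_zero hn, h0]
    simp
  | succ n ih =>
    have hdeg : P.degree ≠ 0 := fun h => by
      rw [natDegree_eq_of_degree_eq_some (n := 0) h] at hn
      omega
    obtain ⟨ρ, hρ⟩ := IsAlgClosed.exists_root P hdeg
    obtain ⟨Q, hQ⟩ := dvd_iff_isRoot.mpr hρ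
    have hρ0 : ρ ≠ 0 := by
      rintro rfl
      rw [IsRoot.def, ← coeff_zero_eq_eval_zero, h0] at hρ
      exact one_ne_zero hρ
    have hP : P = (1 - C ρ⁻¹ * X) * (C (-ρ) * Q) := by
      have : C ρ⁻¹ * C ρ = (1 : ℂ[X]) := by rw [← C_mul, inv_mul_cancel₀ hρ0, C_1]
      rw [hQ, C_neg]
      linear_combination (-X * Q) * this
    have hQ0 : (C (-ρ) * Q).coeff 0 = 1 := by
      rw [hP, mul_coeff_zero] at h0
      simpa using h0
    have hne : C (-ρ) * Q ≠ 0 := fun h => by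
      rw [h, coeff_zero] at hQ0
      exact zero_ne_one hQ0
    have hQn : (C (-ρ) * Q).natDegree = n := by
      have hlin : (1 - C ρ⁻¹ * X : ℂ[X]).natDegree = 1 := by
        rw [show (1 - C ρ⁻¹ * X : ℂ[X]) = C (-ρ⁻¹) * X + C 1 by rw [C_neg, C_1]; ring]
        exact natDegree_linear (neg_ne_zero.mpr (inv_ne_zero hρ0))
      have hlin0 : (1 - C ρ⁻¹ * X : ℂ[X]) ≠ 0 := fun h => by simp [h] at hlin
      rw [hP, natDegree_mul hlin0 hne, hlin] at hn
      omega
    obtain ⟨α, hα⟩ := ih _ hQ0 hQn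
    refine ⟨Fin.cons ρ⁻¹ α, ?_⟩
    rw [Fin.prod_univ_succ]
    simp only [Fin.cons_zero, Fin.cons_succ]
    rw [← hα, ← hP]

/-- The power series `∑ₙ a n * X ^ n` over `n ≥ 1`. -/
noncomputable def tailSeries (a : ℕ → ℂ) : PowerSeries ℂ :=
  PowerSeries.mk fun n => if n = 0 then 0 else a n

lemma tailSeries_pow_mul (α : ℂ) : tailSeries (fun n => α ^ n) *
    (1 - PowerSeries.C α * PowerSeries.X) = PowerSeries.C α * PowerSeries.X := by
  rw [mul_sub, mul_one, mul_left_comm]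
  ext n
  rcases n with _ | n
  · simp [tailSeries]
  · rcases n with _ | n
    · simp [tailSeries, PowerSeries.coeff_succ_mul_X]
    · simp [tailSeries, PowerSeries.coeff_succ_mul_X, pow_succ']

lemma X_mul_derivative_prod_one_sub {ι : Type*} (s : Finset ι) (α : ι → ℂ) :
    PowerSeries.X * PowerSeries.derivative ℂ
        (∏ i ∈ s, (1 - PowerSeries.C (α i) * PowerSeries.X)) =
      -(∑ i ∈ s, tailSeries (fun n => α i ^ n)) *
        ∏ i ∈ s, (1 - PowerSeries.C (α i) * PowerSeries.X) := by
  classical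
  induction s using Finset.induction_on with
  | empty => simp
  | insert a s ha ih =>
    rw [Finset.prod_insert ha, Finset.sum_insert ha, Derivation.leibniz]
    have h1 : PowerSeries.derivative ℂ (1 - PowerSeries.C (α a) * PowerSeries.X) =
        -PowerSeries.C (α a) := by
      rw [map_sub, PowerSeries.derivative_one, Derivation.leibniz, PowerSeries.derivative_C,
        PowerSeries.derivative_X]
      simp
    rw [h1, smul_eq_mul, smul_eq_mul]
    linear_combination (1 - PowerSeries.C (α a) * PowerSeries.X) * ih +
      (∏ i ∈ s, (1 - PowerSeries.C (α i) * PowerSeries.X)) * tailSeries_pow_mul (α a)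

lemma power_sum_eq_of_recurrence {m : ℕ} (α : Fin m → ℂ) (A S : ℕ → ℂ)
    (hA : ∀ n, (∏ i, (1 - C (α i) * X)).coeff n = A n)
    (hrec : ∀ n : ℕ, n * A n = ∑ i ∈ Finset.Icc 1 n, S i * A (n - i)) {n : ℕ} (hn : n ≠ 0) :
    S n = -∑ i, α i ^ n := by
  set P : PowerSeries ℂ := ∏ i, (1 - PowerSeries.C (α i) * PowerSeries.X) with hP
  have hcoe : P = ((∏ i, (1 - C (α i) * X) : ℂ[X]) : PowerSeries ℂ) := by
    rw [hP, ← Polynomial.coeToPowerSeries.ringHom_apply, map_prod]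
    simp
  have hcoeff : ∀ n, PowerSeries.coeff n P = A n := fun n => by
    rw [hcoe, Polynomial.coeff_coe, hA]
  have h1 := X_mul_derivative_prod_one_sub Finset.univ α
  have h2 : PowerSeries.X * PowerSeries.derivative ℂ P = tailSeries S * P := by
    ext n
    have hr : PowerSeries.coeff n (tailSeries S * P) = n * A n := by
      rw [hrec, PowerSeries.coeff_mul, Finset.Nat.sum_antidiagonal_eq_sum_range_succ_mk]
      symm
      have hsub : Finset.Icc 1 n ⊆ Finset.range n.succ := fun i hi => by
        rw [Finset.mem_Icc] at hi
        rw [Finset.mem_range]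
        omega
      refine (Finset.sum_congr rfl fun i hi => ?_).trans (Finset.sum_subset hsub ?_)
      · rw [Finset.mem_Icc] at hi
        rw [hcoeff, tailSeries, PowerSeries.coeff_mk, if_neg (by omega)]
      · intro i hi hi'
        rw [Finset.mem_Icc] at hi'
        rw [Finset.mem_range] at hi
        rw [tailSeries, PowerSeries.coeff_mk, if_pos (by omega), zero_mul]
    rw [hr]
    rcases n with _ | n
    · simp
    · rw [PowerSeries.coeff_succ_X_mul, PowerSeries.coeff_derivative, hcoeff]
      push_cast
      ring
  have hP0 : P ≠ 0 := by
    intro h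
    have h0 : PowerSeries.constantCoeff P = 1 := by simp [hP, map_prod]
    rw [h, map_zero] at h0
    exact zero_ne_one h0
  have h3 := mul_right_cancel₀ hP0 (h2.symm.trans h1)
  have h4 := congrArg (PowerSeries.coeff n) h3
  simpa [tailSeries, hn] using h4

end InverseRoots

section PowerSums

/-- Power sums bounded by a geometric sequence force each term to lie in the corresponding disc. -/
lemma norm_le_of_power_sum_le {ι : Type*} [Fintype ι] (β : ι → ℂ) {B R : ℝ} (hR : 0 < R)
    (h : ∀ k : ℕ, k ≠ 0 → ‖∑ i, β i ^ k‖ ≤ B * R ^ k) (i : ι) : ‖β i‖ ≤ R := by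
  by_contra! hlt
  have hone : 1 < ‖β i‖ / R := (one_lt_div hR).mpr hlt
  have hcl := mapClusterPt_one_atTop_pow (fun j => Circle.exp (β j).arg : ι → Circle)
  have hnhds : ∀ᶠ y : ι → Circle in nhds 1, ∀ j, 1 / 2 < ((y j : Circle) : ℂ).re := by
    rw [Filter.eventually_all]
    intro j
    have hcont : Continuous fun y : ι → Circle => ((y j : Circle) : ℂ).re := by fun_prop
    refine (hcont.tendsto 1).eventually_const_lt ?_
    norm_num
  have hfreq := hcl.frequently hnhds
  have hev : ∀ᶠ k : ℕ in Filter.atTop, 2 * B < (‖β i‖ / R) ^ k ∧ k ≠ 0 :=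
    ((tendsto_pow_atTop_atTop_of_one_lt hone).eventually_gt_atTop _).and
      (Filter.eventually_ne_atTop 0)
  obtain ⟨k, hk1, hk2, hk0⟩ := (hfreq.and_eventually hev).exists
  have hpow : ∀ j, ‖β j‖ ^ k / 2 ≤ (β j ^ k).re := by
    intro j
    have e : β j ^ k = ((‖β j‖ ^ k : ℝ) : ℂ) * (((Circle.exp (β j).arg) ^ k : Circle) : ℂ) := by
      conv_lhs => rw [← Complex.norm_mul_exp_arg_mul_I (β j)]
      rw [mul_pow, Circle.coe_pow, Circle.coe_exp]
      push_cast
      rfl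
    rw [e, Complex.re_ofReal_mul, div_eq_mul_one_div]
    exact mul_le_mul_of_nonneg_left (hk1 j).le (by positivity)
  have hsum : ‖β i‖ ^ k / 2 ≤ B * R ^ k := by
    calc ‖β i‖ ^ k / 2 ≤ ∑ j, ‖β j‖ ^ k / 2 :=
          Finset.single_le_sum (f := fun j => ‖β j‖ ^ k / 2) (fun j _ => by positivity)
            (Finset.mem_univ i)
      _ ≤ ∑ j, (β j ^ k).re := Finset.sum_le_sum fun j _ => hpow j
      _ = (∑ j, β j ^ k).re := (Complex.re_sum _ _).symm
      _ ≤ ‖∑ j, β j ^ k‖ := Complex.re_le_norm _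
      _ ≤ B * R ^ k := h k hk0
  rw [div_pow, lt_div_iff₀ (pow_pos hR k)] at hk2
  linarith

end PowerSums

section ProductBound

lemma norm_one_sub_mul_le {z : ℂ} (hz : ‖z‖ ≤ 1) {t : ℝ} (h0 : 0 ≤ t) (h1 : t ≤ 1) :
    (1 + t) * ‖1 - z‖ ≤ 2 * ‖1 - t * z‖ := by
  have hz2 : z.re ^ 2 + z.im ^ 2 ≤ 1 := by
    have := Complex.sq_norm z
    rw [Complex.normSq_apply] at this
    nlinarith [norm_nonneg z]
  have hre : -1 ≤ z.re := by nlinarith [sq_nonneg z.im]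
  refine le_of_sq_le_sq ?_ (by positivity)
  rw [mul_pow, mul_pow, Complex.sq_norm, Complex.sq_norm, Complex.normSq_apply,
    Complex.normSq_apply]
  simp only [Complex.sub_re, Complex.sub_im, Complex.one_re, Complex.one_im, Complex.re_ofReal_mul,
    Complex.im_ofReal_mul]
  nlinarith [mul_nonneg (sub_nonneg.mpr h1)
      (mul_nonneg (sub_nonneg.mpr h1) (by linarith : 0 ≤ 1 + z.re)),
    mul_nonneg (mul_nonneg (sub_nonneg.mpr h1) (by linarith : 0 ≤ 1 + 3 * t)) (sub_nonneg.mpr hz2)]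

lemma log_norm_one_sub_le {z : ℂ} {t : ℝ} (hz : ‖z‖ ≤ t) (ht : t < 1) (N : ℕ) :
    Real.log ‖1 - z‖ ≤ -(∑ n ∈ Finset.Icc 1 N, z ^ n / n).re + t ^ (N + 1) / (1 - t) := by
  have hz1 : ‖-z‖ < 1 := by
    rw [norm_neg]
    exact hz.trans_lt ht
  have h := Complex.norm_log_sub_logTaylor_le N hz1
  have htaylor : Complex.logTaylor (N + 1) (-z) = -∑ n ∈ Finset.Icc 1 N, z ^ n / n := by
    rw [Complex.logTaylor, Finset.range_eq_Ico, Finset.sum_eq_sum_Ico_succ_bot (by omega),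
      ← Finset.sum_neg_distrib]
    simp only [zero_add, Nat.cast_zero, div_zero]
    refine Finset.sum_congr rfl fun n _ => ?_
    rw [neg_pow z n, pow_succ]
    have : ((-1 : ℂ) ^ n) * (-1) ^ n = 1 := by rw [← mul_pow]; simp
    linear_combination (-z ^ n / n) * this
  rw [htaylor, norm_neg, ← sub_eq_add_neg] at h
  have hlog : (Complex.log (1 - z)).re = Real.log ‖1 - z‖ := Complex.log_re _
  have hre := (Complex.re_le_norm _).trans h
  rw [Complex.sub_re, hlog, Complex.neg_re] at hre
  have hpow : ‖z‖ ^ (N + 1) * (1 - ‖z‖)⁻¹ / (N + 1) ≤ t ^ (N + 1) / (1 - t) := by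
    have h1 : 0 < 1 - t := by linarith
    calc ‖z‖ ^ (N + 1) * (1 - ‖z‖)⁻¹ / (N + 1) ≤ ‖z‖ ^ (N + 1) * (1 - ‖z‖)⁻¹ := by
          refine div_le_self ?_ (by linarith [(Nat.cast_nonneg N : (0 : ℝ) ≤ N)])
          have : 0 ≤ 1 - ‖z‖ := by linarith
          positivity
      _ ≤ t ^ (N + 1) * (1 - t)⁻¹ := by
          have : 0 ≤ 1 - ‖z‖ := by linarith
          have := (norm_nonneg z).trans hz
          gcongr
      _ = t ^ (N + 1) / (1 - t) := (div_eq_mul_inv _ _).symm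
  linarith

/-- A subexponential bound at the boundary for products `∏ (1 - w i)` over the unit disc whose
power sums are bounded independently of the number of factors. -/
lemma exists_prod_norm_one_sub_le (b : ℕ → ℝ) {ε : ℝ} (hε : 0 < ε) :
    ∃ c : ℝ, ∀ (m : ℕ) (w : Fin m → ℂ), (∀ i, ‖w i‖ ≤ 1) →
      (∀ n, n ≠ 0 → ‖∑ i, w i ^ n‖ ≤ b n) → ∏ i, ‖1 - w i‖ ≤ Real.exp (c + ε * m) := by
  set t : ℝ := max (1 / 2) (2 * Real.exp (-(ε / 2)) - 1) with ht
  have ht0 : 0 < t := lt_of_lt_of_le (by norm_num) (le_max_left _ _)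
  have ht1 : t < 1 := by
    have : Real.exp (-(ε / 2)) < 1 := Real.exp_lt_one_iff.mpr (by linarith)
    exact max_lt (by norm_num) (by linarith)
  have hfac : 2 / (1 + t) ≤ Real.exp (ε / 2) := by
    have h1 : 2 * Real.exp (-(ε / 2)) ≤ 1 + t := by
      linarith [le_max_right (1 / 2) (2 * Real.exp (-(ε / 2)) - 1)]
    rw [div_le_iff₀ (by linarith)]
    calc (2 : ℝ) = Real.exp (ε / 2) * (2 * Real.exp (-(ε / 2))) := by
          rw [mul_left_comm, ← Real.exp_add, add_neg_cancel, Real.exp_zero, mul_one]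
      _ ≤ Real.exp (ε / 2) * (1 + t) := by gcongr
  obtain ⟨N, hN⟩ : ∃ N : ℕ, t ^ N < ε / 2 * (1 - t) :=
    exists_pow_lt_of_lt_one (mul_pos (by linarith) (by linarith)) ht1
  have hN' : t ^ (N + 1) / (1 - t) ≤ ε / 2 := by
    rw [div_le_iff₀ (by linarith)]
    exact (pow_le_pow_of_le_one ht0.le ht1.le N.le_succ).trans hN.le
  refine ⟨∑ n ∈ Finset.Icc 1 N, b n, fun m w hw hb => ?_⟩
  have hwt : ∀ i, ‖t * w i‖ ≤ t := fun i => by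
    rw [norm_mul, Complex.norm_real, Real.norm_of_nonneg ht0.le]
    exact mul_le_of_le_one_right ht0.le (hw i)
  have hpos : ∀ i, 0 < ‖1 - t * w i‖ := fun i => by
    rw [norm_pos_iff, sub_ne_zero]
    intro h
    have := hwt i
    rw [← h, norm_one] at this
    linarith
  have hprod : ∏ i, ‖1 - t * w i‖ ≤ Real.exp (∑ n ∈ Finset.Icc 1 N, b n + ε / 2 * m) := by
    rw [← Real.log_le_iff_le_exp (Finset.prod_pos fun i _ => hpos i),
      Real.log_prod (fun i _ => (hpos i).ne')]
    calc ∑ i, Real.log ‖1 - t * w i‖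
        ≤ ∑ i, (-(∑ n ∈ Finset.Icc 1 N, (t * w i) ^ n / n).re + ε / 2) :=
          Finset.sum_le_sum fun i _ => (log_norm_one_sub_le (hwt i) ht1 N).trans (by linarith)
      _ = -(∑ n ∈ Finset.Icc 1 N, (t : ℂ) ^ n / n * ∑ i, w i ^ n).re + ε / 2 * m := by
          rw [Finset.sum_add_distrib, Finset.sum_neg_distrib, ← Complex.re_sum, Finset.sum_comm]
          simp only [Finset.sum_const, Finset.card_univ, Fintype.card_fin, nsmul_eq_mul,
            Finset.mul_sum, mul_pow]
          rw [mul_comm (m : ℝ)]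
          congr 4
          funext n
          refine Finset.sum_congr rfl fun i _ => ?_
          ring
      _ ≤ ∑ n ∈ Finset.Icc 1 N, b n + ε / 2 * m := by
          gcongr
          rw [← Complex.neg_re]
          refine (Complex.re_le_norm _).trans ?_
          rw [norm_neg]
          refine (norm_sum_le _ _).trans (Finset.sum_le_sum fun n hn => ?_)
          rw [Finset.mem_Icc] at hn
          refine le_trans ?_ (hb n (by omega))
          rw [norm_mul]
          refine mul_le_of_le_one_left (norm_nonneg _) ?_
          rw [norm_div, norm_pow, Complex.norm_real, Real.norm_of_nonneg ht0.le,
            Complex.norm_natCast]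
          have : (1 : ℝ) ≤ n := by exact_mod_cast hn.1
          exact div_le_one_of_le₀ ((pow_le_one₀ ht0.le ht1.le).trans this) (by linarith)
  calc ∏ i, ‖1 - w i‖ ≤ ∏ i, (2 / (1 + t) * ‖1 - t * w i‖) := by
        refine Finset.prod_le_prod (fun i _ => norm_nonneg _) fun i _ => ?_
        rw [div_mul_eq_mul_div, le_div_iff₀ (by linarith), mul_comm]
        exact norm_one_sub_mul_le (hw i) ht0.le ht1.le
    _ = (2 / (1 + t)) ^ m * ∏ i, ‖1 - t * w i‖ := by
        rw [Finset.prod_mul_distrib, Finset.prod_const, Finset.card_univ, Fintype.card_fin]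
    _ ≤ Real.exp (ε / 2) ^ m * Real.exp (∑ n ∈ Finset.Icc 1 N, b n + ε / 2 * m) := by
        have : 0 ≤ 2 / (1 + t) := by positivity
        gcongr
    _ = Real.exp (∑ n ∈ Finset.Icc 1 N, b n + ε * m) := by
        rw [← Real.exp_nat_mul, ← Real.exp_add]
        congr 1
        ring

end ProductBound

section CentralValue

variable {F : Type} [Field F] [Fintype F]

/-- The numerator polynomial of `L(s, χ_d)` in the variable `q ^ (-s)`. -/
noncomputable def lPoly (d : F[X]) : ℂ[X] :=
  ∑ n ∈ Finset.range d.natDegree, C (charSum d n : ℂ) * X ^ n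

lemma coeff_lPoly (h4 : Fintype.card F % 4 = 1) {d : F[X]} (hd : d.Monic) (hsq : Squarefree d)
    (hdeg : 1 ≤ d.natDegree) (n : ℕ) : (lPoly d).coeff n = charSum d n := by
  rw [lPoly, finsetSum_coeff]
  simp only [coeff_C_mul, coeff_X_pow, mul_ite, mul_one, mul_zero]
  rw [Finset.sum_ite_eq]
  split_ifs with h
  · rfl
  · rw [Finset.mem_range, not_lt] at h
    rw [charSum_eq_zero h4 hd hsq hdeg h, Int.cast_zero]

lemma natDegree_lPoly_le (d : F[X]) : (lPoly d).natDegree ≤ d.natDegree :=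
  natDegree_sum_le_of_forall_le _ _ fun _ hn =>
    (natDegree_C_mul_X_pow_le _ _).trans (Finset.mem_range.mp hn).le

lemma Lhalf_eq_eval_lPoly (d : F[X]) :
    (Lhalf (Fintype.card F) d : ℂ) = (lPoly d).eval ((√(Fintype.card F) : ℝ) : ℂ)⁻¹ := by
  rw [Lhalf, lPoly, eval_finsetSum]
  push_cast
  refine Finset.sum_congr rfl fun n _ => ?_
  have h : ((Fintype.card F : ℝ)) ^ (-(n : ℝ) / 2) = (√(Fintype.card F : ℝ))⁻¹ ^ n := by
    rw [Real.sqrt_eq_rpow, ← Real.rpow_neg (Nat.cast_nonneg _), ← Real.rpow_natCast,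
      ← Real.rpow_mul (Nat.cast_nonneg _)]
    congr 1
    ring
  rw [h, ← sum_quadChar_monicOf, eval_C_mul, eval_X_pow]
  push_cast
  ring

/-- The Riemann hypothesis for `L(s, χ_d)`. -/
lemma norm_inverse_root_le (h4 : Fintype.card F % 4 = 1) {d : F[X]} (hsq : Squarefree d)
    (hdeg : 1 ≤ d.natDegree) {m : ℕ} (α : Fin m → ℂ)
    (hα : ∀ n, n ≠ 0 → (primeSum d n : ℂ) = -∑ i, α i ^ n) (i : Fin m) :
    ‖α i‖ ≤ √(Fintype.card F) := by
  obtain ⟨r, hr, hbound⟩ := exists_abs_primeSum_le (ringChar_ne_two_of_card h4) hsq hdeg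
  have hq : (0 : ℝ) < Fintype.card F := by exact_mod_cast Fintype.card_pos
  have h1 := norm_le_of_power_sum_le (fun i => α i ^ (2 * r)) (B := d.natDegree + 1)
    (pow_pos hq r) (fun k hk => ?_) i
  · have h2 : ‖α i‖ ^ (2 * r) ≤ √(Fintype.card F) ^ (2 * r) := by
      rwa [pow_mul √_, Real.sq_sqrt hq.le, ← norm_pow]
    exact le_of_pow_le_pow_left₀ (by omega) (Real.sqrt_nonneg _) h2
  · have h3 : ∑ i, (α i ^ (2 * r)) ^ k = -(primeSum d (2 * r * k) : ℂ) := by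
      rw [hα _ (by positivity), neg_neg]
      simp only [pow_mul]
    rw [h3, norm_neg, Complex.norm_intCast, ← pow_mul]
    exact_mod_cast hbound k hk

lemma exists_abs_Lhalf_le (h4 : Fintype.card F % 4 = 1) {ε : ℝ} (hε : 0 < ε) :
    ∃ c : ℝ, ∀ d : F[X], d.Monic → Squarefree d → 1 ≤ d.natDegree →
      |Lhalf (Fintype.card F) d| ≤ Real.exp (c + ε * d.natDegree) := by
  obtain ⟨c, hc⟩ := exists_prod_norm_one_sub_le (fun n => (Fintype.card F : ℝ) ^ n) hε
  refine ⟨c, fun d hd hsq hdeg => ?_⟩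
  have hcoeff := coeff_lPoly h4 hd hsq hdeg
  obtain ⟨α, hα⟩ := exists_eq_prod_one_sub (lPoly d) (by rw [hcoeff, charSum_zero, Int.cast_one])
  have hpow : ∀ n, n ≠ 0 → (primeSum d n : ℂ) = -∑ i, α i ^ n := fun n hn =>
    power_sum_eq_of_recurrence α (fun n => charSum d n) (fun n => primeSum d n)
      (fun n => by rw [← hα, hcoeff]) (fun n => by exact_mod_cast mul_charSum d n) hn
  have hq : (1 : ℝ) ≤ √(Fintype.card F) := by
    rw [Real.one_le_sqrt]
    exact_mod_cast Fintype.card_pos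
  have hroot := norm_inverse_root_le h4 hsq hdeg α hpow
  have hval : |Lhalf (Fintype.card F) d| = ∏ i, ‖1 - α i * ((√(Fintype.card F) : ℝ) : ℂ)⁻¹‖ := by
    rw [← Real.norm_eq_abs, ← Complex.norm_real, Lhalf_eq_eval_lPoly]
    conv_lhs => rw [hα]
    rw [eval_prod, norm_prod]
    simp
  rw [hval]
  refine (hc _ _ (fun i => ?_) fun n hn => ?_).trans ?_
  · rw [norm_mul, norm_inv, Complex.norm_real, Real.norm_of_nonneg (by linarith),
      ← div_eq_mul_inv, div_le_one (by linarith)]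
    exact hroot i
  · simp only [mul_pow]
    rw [← Finset.sum_mul, ← neg_neg (∑ i, α i ^ n), ← hpow n hn, norm_mul, norm_neg,
      Complex.norm_intCast, norm_pow, norm_inv, Complex.norm_real,
      Real.norm_of_nonneg (by linarith)]
    refine (mul_le_of_le_one_right (abs_nonneg _)
      (pow_le_one₀ (by positivity) (inv_le_one_of_one_le₀ hq))).trans ?_
    exact_mod_cast abs_primeSum_le (ringChar_ne_two_of_card h4) d hn
  · have : ((lPoly d).natDegree : ℝ) ≤ d.natDegree := by exact_mod_cast natDegree_lPoly_le d
    gcongr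

lemma summable_sigma_pow {ι : Type*} [Fintype ι] {ρ : ℝ} (h0 : 0 ≤ ρ)
    (h1 : Fintype.card ι * ρ < 1) : Summable fun x : Σ n : ℕ, (Fin n → ι) => ρ ^ x.1 := by
  refine (summable_sigma_of_nonneg fun x => pow_nonneg h0 _).mpr
    ⟨fun n => Summable.of_finite, ?_⟩
  refine (summable_geometric_of_lt_one (by positivity) h1).congr fun n => ?_
  dsimp only
  rw [tsum_fintype, Finset.sum_const, Finset.card_univ, Fintype.card_fun, Fintype.card_fin,
    nsmul_eq_mul, mul_pow, Nat.cast_pow]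

omit [Fintype F] in
lemma exists_injective_sigma : ∃ i : {d : F[X] // d.Monic} → Σ n : ℕ, (Fin n → F),
    (∀ d, (i d).1 = d.1.natDegree) ∧ Function.Injective i := by
  have hex : ∀ d : {d : F[X] // d.Monic}, ∃ x : Σ n : ℕ, (Fin n → F), x.1 = d.1.natDegree ∧
      monicOf x.1 x.2 = d.1 := fun d => by
    obtain ⟨a, ha⟩ := monicOf_surj d.2 rfl
    exact ⟨⟨_, a⟩, rfl, ha⟩
  choose i hi hi' using hex
  exact ⟨i, hi, fun d d' h => Subtype.ext (by rw [← hi' d, ← hi' d', h])⟩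

lemma summable_pow_natDegree {ρ : ℝ} (h0 : 0 ≤ ρ) (h1 : Fintype.card F * ρ < 1) :
    Summable fun d : {d : F[X] // d.Monic} => ρ ^ d.1.natDegree := by
  obtain ⟨i, hi, hinj⟩ := exists_injective_sigma (F := F)
  refine ((summable_sigma_pow h0 h1).comp_injective hinj).congr fun d => ?_
  rw [Function.comp_apply, hi]

end CentralValue

/-- For every real `w > 1`, the family `|L(1/2, χ_{d₀})|³ · q^{−w·deg d₀}`, indexed by the
non-constant monic squarefree polynomials `d₀ ∈ F[x]`, is summable. -/
theorem stmt_18 (q : ℕ) (F : Type) [Field F] [Fintype F] (hF : Fintype.card F = q)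
    (h4 : q % 4 = 1) (w : ℝ) (hw : 1 < w) :
    Summable (fun d : {d : Polynomial F // d.Monic ∧ Squarefree d ∧ 1 ≤ d.natDegree} =>
      |Lhalf q d.1| ^ 3 * (q : ℝ) ^ (-(w * (d.1.natDegree : ℝ)))) := by
  subst hF
  have hq : (1 : ℝ) < Fintype.card F := by exact_mod_cast Fintype.one_lt_card
  have hlog : 0 < Real.log (Fintype.card F) := Real.log_pos hq
  have hδ : 0 < (w - 1) * Real.log (Fintype.card F) / 6 := by
    have : 0 < w - 1 := by linarith
    positivity
  obtain ⟨c, hc⟩ := exists_abs_Lhalf_le h4 hδ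
  set δ := (w - 1) * Real.log (Fintype.card F) / 6 with hδ'
  have hρ : Fintype.card F * Real.exp (3 * δ - w * Real.log (Fintype.card F)) < 1 := by
    conv_lhs => rw [← Real.exp_log (zero_lt_one.trans hq), ← Real.exp_add]
    rw [Real.exp_lt_one_iff, Real.log_exp]
    linarith
  have hsum := (summable_pow_natDegree (Real.exp_pos _).le hρ).mul_left (Real.exp (3 * c))
  refine Summable.of_nonneg_of_le (fun d => by positivity) (fun d => ?_)
    (hsum.comp_injective (i := fun d : {d : Polynomial F // d.Monic ∧ Squarefree d ∧
      1 ≤ d.natDegree} => ⟨d.1, d.2.1⟩) fun d d' h => Subtype.ext (congrArg (fun x => x.1) h))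
  rw [Function.comp_apply]
  calc |Lhalf (Fintype.card F) d.1| ^ 3 * (Fintype.card F : ℝ) ^ (-(w * (d.1.natDegree : ℝ)))
      ≤ Real.exp (c + δ * d.1.natDegree) ^ 3 *
          (Fintype.card F : ℝ) ^ (-(w * (d.1.natDegree : ℝ))) := by
        gcongr
        exact hc d.1 d.2.1 d.2.2.1 d.2.2.2
    _ = Real.exp (3 * c) *
          Real.exp (3 * δ - w * Real.log (Fintype.card F)) ^ d.1.natDegree := by
        rw [Real.rpow_def_of_pos (zero_lt_one.trans hq), ← Real.exp_nat_mul, ← Real.exp_nat_mul,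
          ← Real.exp_add, ← Real.exp_add]
        congr 1
        push_cast
        ring
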